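/- arXiv:1410.8144 — 3 statements merged into one kernel-verified Lean document; each statement's English description precedes it below -/
import Mathlib

section
/- Let 1 < a ≤ b ≤ c ≤ ab and let (H,z), with H = (H_A,H_B,H_C) traceless, be a non-trivial facet normal of C(a,b,c). Then the face F(H,z) contains a point (λ_A,λ_B,λ_C) such that λ_A, λ_B, and λ_C each have strictly decreasing entries. -/
open scoped BigOperators

noncomputable section

/-- The reduced density matrix on the first subsystem. -/
def rhoA {a b c : ℕ} (ψ : Fin a × Fin b × Fin c → ℂ) : Matrix (Fin a) (Fin a) ℂ :=
  Matrix.of fun i i' => ∑ j : Fin b, ∑ k : Fin c, ψ (i, j, k) * (starRingEnd ℂ) (ψ (i', j, k))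

/-- The reduced density matrix on the second subsystem. -/
def rhoB {a b c : ℕ} (ψ : Fin a × Fin b × Fin c → ℂ) : Matrix (Fin b) (Fin b) ℂ :=
  Matrix.of fun j j' => ∑ i : Fin a, ∑ k : Fin c, ψ (i, j, k) * (starRingEnd ℂ) (ψ (i, j', k))

/-- The reduced density matrix on the third subsystem. -/
def rhoC {a b c : ℕ} (ψ : Fin a × Fin b × Fin c → ℂ) : Matrix (Fin c) (Fin c) ℂ :=
  Matrix.of fun k k' => ∑ i : Fin a, ∑ j : Fin b, ψ (i, j, k) * (starRingEnd ℂ) (ψ (i, j, k'))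

/-- `lam` is the vector of eigenvalues of `ρ`, listed in nonincreasing order
with multiplicity. -/
def IsSpecDown {n : ℕ} (ρ : Matrix (Fin n) (Fin n) ℂ) (lam : Fin n → ℝ) : Prop :=
  Antitone lam ∧ ∃ (hρ : ρ.IsHermitian) (σ : Equiv.Perm (Fin n)), lam = hρ.eigenvalues ∘ σ

/-- The Kronecker cone `C(a,b,c)`. -/
def KronCone (a b c : ℕ) : Set ((Fin a → ℝ) × (Fin b → ℝ) × (Fin c → ℝ)) :=
  { lam | ∃ ψ : Fin a × Fin b × Fin c → ℂ,
      IsSpecDown (rhoA ψ) lam.1 ∧ IsSpecDown (rhoB ψ) lam.2.1 ∧ IsSpecDown (rhoC ψ) lam.2.2 }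

/-- The pairing `⟨(H,z), λ⟩`. -/
def wtPair {a b c : ℕ} (HA : Fin a → ℝ) (HB : Fin b → ℝ) (HC : Fin c → ℝ) (z : ℝ)
    (lam : (Fin a → ℝ) × (Fin b → ℝ) × (Fin c → ℝ)) : ℝ :=
  (∑ i, HA i * lam.1 i) + (∑ j, HB j * lam.2.1 j) + (∑ k, HC k * lam.2.2 k)
    + z * ∑ i, lam.1 i

/-- `H = (H_A, H_B, H_C)` is traceless. -/
def Traceless {a b c : ℕ} (HA : Fin a → ℝ) (HB : Fin b → ℝ) (HC : Fin c → ℝ) : Prop :=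
  (∑ i, HA i) = 0 ∧ (∑ j, HB j) = 0 ∧ (∑ k, HC k) = 0

/-- `(H, z)` is a facet normal of the Kronecker cone `C(a,b,c)`. -/
def IsFacetNormal (a b c : ℕ) (HA : Fin a → ℝ) (HB : Fin b → ℝ) (HC : Fin c → ℝ)
    (z : ℝ) : Prop :=
  Traceless HA HB HC ∧ ¬(HA = 0 ∧ HB = 0 ∧ HC = 0 ∧ z = 0) ∧
  (∀ lam ∈ KronCone a b c, 0 ≤ wtPair HA HB HC z lam) ∧
  Module.finrank ℝ
    (affineSpan ℝ {lam ∈ KronCone a b c | wtPair HA HB HC z lam = 0}).direction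
    = a + b + c - 3

/-- `(H, z)` is a trivial (Weyl chamber) normal. -/
def IsTrivialNormal {a b c : ℕ} (HA : Fin a → ℝ) (HB : Fin b → ℝ) (HC : Fin c → ℝ)
    (z : ℝ) : Prop :=
  ∃ t : ℝ, 0 < t ∧
    ((∃ i i' : Fin a, i < i' ∧ HA = t • (Pi.single i 1 - Pi.single i' 1) ∧
        HB = 0 ∧ HC = 0 ∧ z = 0) ∨
     (∃ j j' : Fin b, j < j' ∧ HB = t • (Pi.single j 1 - Pi.single j' 1) ∧
        HA = 0 ∧ HC = 0 ∧ z = 0) ∨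
     (∃ k k' : Fin c, k < k' ∧ HC = t • (Pi.single k 1 - Pi.single k' 1) ∧
        HA = 0 ∧ HB = 0 ∧ z = 0))

/-- The subspace of vectors supported on coordinates satisfying `P`. -/
def suppSubmodule {ι : Type*} (P : ι → Prop) : Submodule ℂ (ι → ℂ) where
  carrier := {ψ | ∀ p, ¬ P p → ψ p = 0}
  add_mem' := by
    intro x y hx hy p hp
    simp only [Pi.add_apply, hx p hp, hy p hp, add_zero]
  zero_mem' := by intro p _; rfl
  smul_mem' := by
    intro r x hx p hp
    simp only [Pi.smul_apply, hx p hp, smul_zero]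

/-- The zero-weight space `ℋ₀(H,z)`. -/
def weight0Space {a b c : ℕ} (HA : Fin a → ℝ) (HB : Fin b → ℝ) (HC : Fin c → ℝ)
    (z : ℝ) : Submodule ℂ (Fin a × Fin b × Fin c → ℂ) :=
  suppSubmodule fun p => HA p.1 + HB p.2.1 + HC p.2.2 + z = 0

/-- The negative-weight space `ℋ₋(H,z)`. -/
def weightNegSpace {a b c : ℕ} (HA : Fin a → ℝ) (HB : Fin b → ℝ) (HC : Fin c → ℝ)
    (z : ℝ) : Submodule ℂ (Fin a × Fin b × Fin c → ℂ) :=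
  suppSubmodule fun p => HA p.1 + HB p.2.1 + HC p.2.2 + z < 0

/-- Strictly lower triangular matrices `X` with `X i' i = 0` unless
`i < i'` and `Hv i' < Hv i`. -/
def lowerMod {d : ℕ} (Hv : Fin d → ℝ) : Submodule ℂ (Matrix (Fin d) (Fin d) ℂ) where
  carrier := {X | ∀ i' i, ¬ (i < i' ∧ Hv i' < Hv i) → X i' i = 0}
  add_mem' := by
    intro X Y hX hY i' i h
    simp only [Matrix.add_apply, hX i' i h, hY i' i h, add_zero]
  zero_mem' := by intro i' i h; rfl
  smul_mem' := by
    intro r X hX i' i h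
    simp only [Matrix.smul_apply, hX i' i h, smul_zero]

/-- The nilpotent algebra `𝔫₋(H)`. -/
def nMinusMod {a b c : ℕ} (HA : Fin a → ℝ) (HB : Fin b → ℝ) (HC : Fin c → ℝ) :
    Submodule ℂ (Matrix (Fin a) (Fin a) ℂ × Matrix (Fin b) (Fin b) ℂ ×
      Matrix (Fin c) (Fin c) ℂ) :=
  (lowerMod HA).prod ((lowerMod HB).prod (lowerMod HC))

/-- The infinitesimal action `(X,Y,Z) ↦ (X⊗I⊗I + I⊗Y⊗I + I⊗I⊗Z)ψ`. -/
def act {a b c : ℕ}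
    (t : Matrix (Fin a) (Fin a) ℂ × Matrix (Fin b) (Fin b) ℂ × Matrix (Fin c) (Fin c) ℂ)
    (ψ : Fin a × Fin b × Fin c → ℂ) : Fin a × Fin b × Fin c → ℂ := fun p =>
  (∑ i', t.1 p.1 i' * ψ (i', p.2.1, p.2.2)) +
  (∑ j', t.2.1 p.2.1 j' * ψ (p.1, j', p.2.2)) +
  (∑ k', t.2.2 p.2.2 k' * ψ (p.1, p.2.1, k'))

/-- The action as a linear map in `(X,Y,Z)`. -/
def actL {a b c : ℕ} (ψ : Fin a × Fin b × Fin c → ℂ) :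
    (Matrix (Fin a) (Fin a) ℂ × Matrix (Fin b) (Fin b) ℂ × Matrix (Fin c) (Fin c) ℂ)
      →ₗ[ℂ] (Fin a × Fin b × Fin c → ℂ) where
  toFun t := act t ψ
  map_add' t s := by
    funext p
    simp only [act, Prod.fst_add, Prod.snd_add, Matrix.add_apply, add_mul,
      Finset.sum_add_distrib, Pi.add_apply]
    ring
  map_smul' r t := by
    funext p
    simp only [act, Prod.smul_fst, Prod.smul_snd, Matrix.smul_apply, smul_eq_mul,
      Pi.smul_apply, RingHom.id_apply, Finset.mul_sum, mul_assoc, mul_add]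

/-- The tangent map `T_ψ : 𝔫₋(H) → ℋ₋(H,z)` is a linear isomorphism. -/
def TangentIso {a b c : ℕ} (HA : Fin a → ℝ) (HB : Fin b → ℝ) (HC : Fin c → ℝ)
    (z : ℝ) (ψ : Fin a × Fin b × Fin c → ℂ) : Prop :=
  ∃ h : ∀ t ∈ nMinusMod HA HB HC, actL ψ t ∈ weightNegSpace HA HB HC z,
    Function.Bijective ((actL ψ).restrict h)

/-- The tangent map `T_ψ : 𝔫₋(H) → ℋ₋(H,z)` is surjective. -/
def TangentSurj {a b c : ℕ} (HA : Fin a → ℝ) (HB : Fin b → ℝ) (HC : Fin c → ℝ)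
    (z : ℝ) (ψ : Fin a × Fin b × Fin c → ℂ) : Prop :=
  ∃ h : ∀ t ∈ nMinusMod HA HB HC, actL ψ t ∈ weightNegSpace HA HB HC z,
    Function.Surjective ((actL ψ).restrict h)

/-- `(H,z)` is admissible: the hyperplane `⟨(H,z), ·⟩ = 0` in `V` is spanned by
the weights of zero `(H,z)`-weight. -/
def Admissible {a b c : ℕ} (HA : Fin a → ℝ) (HB : Fin b → ℝ) (HC : Fin c → ℝ)
    (z : ℝ) : Prop :=
  (Submodule.span ℝ
    { w : (Fin a → ℝ) × (Fin b → ℝ) × (Fin c → ℝ) |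
      ∃ i j k, HA i + HB j + HC k + z = 0 ∧
        w = (Pi.single i 1, Pi.single j 1, Pi.single k 1) } : Set _)
  = { lam | (∑ i, lam.1 i) = (∑ j, lam.2.1 j) ∧ (∑ i, lam.1 i) = (∑ k, lam.2.2 k) ∧
        wtPair HA HB HC z lam = 0 }

/-- `(H,z)` is a Ressayre element. -/
def IsRessayre {a b c : ℕ} (HA : Fin a → ℝ) (HB : Fin b → ℝ) (HC : Fin c → ℝ)
    (z : ℝ) : Prop :=
  Traceless HA HB HC ∧ ¬(HA = 0 ∧ HB = 0 ∧ HC = 0 ∧ z = 0) ∧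
  Admissible HA HB HC z ∧
  ∃ ψ ∈ weight0Space HA HB HC z, TangentIso HA HB HC z ψ

/-- `(H_A, H_B)` satisfies the extremal-edge condition. -/
def ExtremalEdge {a b : ℕ} (HA : Fin a → ℝ) (HB : Fin b → ℝ) : Prop :=
  (∑ i, HA i) = 0 ∧ (∑ j, HB j) = 0 ∧ ¬(HA = 0 ∧ HB = 0) ∧
  ∀ (x : Fin a → ℝ) (y : Fin b → ℝ), (∑ i, x i) = 0 → (∑ j, y j) = 0 →
    (∀ i j k l, HA i + HB j = HA k + HB l → x i + y j = x k + y l) →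
    ∃ t : ℝ, x = t • HA ∧ y = t • HB

/-- The Kronecker product of a family of square matrices. -/
def kron {τ : Type*} [Fintype τ] {α : τ → Type*} (M : ∀ t, Matrix (α t) (α t) ℂ) :
    Matrix (∀ t, α t) (∀ t, α t) ℂ :=
  Matrix.of fun x y => ∏ t, M t (x t) (y t)

section Kron

variable {τ : Type*} [Fintype τ] {α : τ → Type*}

lemma kron_mul [DecidableEq τ] [∀ t, Fintype (α t)] (M M' : ∀ t, Matrix (α t) (α t) ℂ) :
    kron (fun t => M t * M' t) = kron M * kron M' := by
  ext x y
  simp only [kron, Matrix.mul_apply, Matrix.of_apply, Finset.prod_univ_sum,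
    Fintype.piFinset_univ, Finset.prod_mul_distrib]

lemma kron_diagonal [∀ t, DecidableEq (α t)] [DecidableEq (∀ t, α t)] (D : ∀ t, α t → ℂ) :
    kron (fun t => Matrix.diagonal (D t)) = Matrix.diagonal fun x => ∏ t, D t (x t) := by
  ext x y
  by_cases h : x = y
  · subst h
    simp [kron]
  · rw [Matrix.diagonal_apply_ne _ h]
    obtain ⟨t, ht⟩ := Function.ne_iff.mp h
    exact Finset.prod_eq_zero (Finset.mem_univ t) (Matrix.diagonal_apply_ne _ ht)

lemma kron_one [∀ t, DecidableEq (α t)] [DecidableEq (∀ t, α t)] :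
    kron (fun t => (1 : Matrix (α t) (α t) ℂ)) = 1 := by
  have h := kron_diagonal (τ := τ) (α := α) (fun _ _ => 1)
  simpa using h

lemma kron_conjTranspose (M : ∀ t, Matrix (α t) (α t) ℂ) :
    kron (fun t => (M t).conjTranspose) = (kron M).conjTranspose := by
  ext x y
  simp [kron, Matrix.conjTranspose_apply]

end Kron

/-- The squared Euclidean norm. -/
def nsq {ι : Type*} [Fintype ι] (v : ι → ℂ) : ℝ := ∑ x, ‖v x‖ ^ 2

section Nsq

variable {ι : Type*} [Fintype ι]

lemma nsq_nonneg (v : ι → ℂ) : 0 ≤ nsq v := Finset.sum_nonneg fun _ _ => sq_nonneg _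

lemma nsq_eq_zero {v : ι → ℂ} : nsq v = 0 ↔ v = 0 := by
  rw [nsq, Finset.sum_eq_zero_iff_of_nonneg fun _ _ => sq_nonneg _]
  simp [funext_iff]

lemma nsq_smul (r : ℂ) (v : ι → ℂ) : nsq (r • v) = ‖r‖ ^ 2 * nsq v := by
  simp [nsq, Finset.mul_sum, mul_pow]

lemma dotProduct_star_self (v : ι → ℂ) : star v ⬝ᵥ v = (nsq v : ℂ) := by
  simp only [dotProduct, nsq, Pi.star_apply, Complex.ofReal_sum]
  refine Finset.sum_congr rfl fun x _ => ?_
  rw [mul_comm]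
  simpa using Complex.mul_conj' (v x)

lemma norm_dotProduct_sq_le (v w : ι → ℂ) : ‖star v ⬝ᵥ w‖ ^ 2 ≤ nsq v * nsq w := by
  have h1 : ‖star v ⬝ᵥ w‖ ≤ ∑ x, ‖v x‖ * ‖w x‖ := by
    refine (norm_sum_le _ _).trans (le_of_eq ?_)
    simp
  calc ‖star v ⬝ᵥ w‖ ^ 2 ≤ (∑ x, ‖v x‖ * ‖w x‖) ^ 2 := by gcongr
    _ ≤ _ := Finset.sum_mul_sq_le_sq_mul_sq _ _ _

lemma nsq_mulVec [DecidableEq ι] (M : Matrix ι ι ℂ) (v : ι → ℂ) :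
    (nsq (M.mulVec v) : ℂ) = star v ⬝ᵥ (M.conjTranspose * M).mulVec v := by
  rw [← dotProduct_star_self, Matrix.star_mulVec, ← Matrix.mulVec_mulVec,
    ← Matrix.dotProduct_mulVec]

lemma nsq_mulVec_of_unitary [DecidableEq ι] {M : Matrix ι ι ℂ} (hM : M.conjTranspose * M = 1)
    (v : ι → ℂ) : nsq (M.mulVec v) = nsq v := by
  have h := nsq_mulVec M v
  rw [hM, Matrix.one_mulVec, dotProduct_star_self] at h
  exact_mod_cast h

lemma continuous_nsq : Continuous (nsq : (ι → ℂ) → ℝ) := by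
  unfold nsq; fun_prop

lemma isCompact_nsq_eq_one : IsCompact {v : ι → ℂ | nsq v = 1} := by
  refine (isCompact_univ_pi fun _ : ι => isCompact_closedBall (0 : ℂ) 1).of_isClosed_subset
    (isClosed_eq continuous_nsq continuous_const) fun v hv x _ => ?_
  have h : ‖v x‖ ^ 2 ≤ 1 := by
    rw [← (show nsq v = 1 from hv)]
    exact Finset.single_le_sum (f := fun x => ‖v x‖ ^ 2) (fun _ _ => sq_nonneg _)
      (Finset.mem_univ x)
  rw [mem_closedBall_zero_iff]
  nlinarith [norm_nonneg (v x)]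

end Nsq

/-- The tensor power of a vector. -/
def tpow {ι : Type*} (N : ℕ) (ψ : ι → ℂ) : (Fin N → ι) → ℂ := fun x => ∏ t, ψ (x t)

section Tpow

variable {ι : Type*} [Fintype ι] (N : ℕ)

lemma kron_mulVec_tpow (M : Matrix ι ι ℂ) (ψ : ι → ℂ) :
    (kron fun _ : Fin N => M).mulVec (tpow N ψ) = tpow N (M.mulVec ψ) := by
  ext x
  simp only [Matrix.mulVec, dotProduct, kron, tpow, Matrix.of_apply, Finset.prod_univ_sum,
    Fintype.piFinset_univ, Finset.prod_mul_distrib]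

lemma nsq_tpow (ψ : ι → ℂ) : nsq (tpow N ψ) = nsq ψ ^ N := by
  simp only [nsq, tpow, norm_prod]
  rw [← Fin.prod_const N, Finset.prod_univ_sum]
  simp [Finset.prod_pow]

end Tpow

/-- The local operator `⨂ f, g f` on the tensor product of the spaces `ℂ ^ d f`. -/
abbrev loc {F : Type*} [Fintype F] {d : F → ℕ} (g : ∀ f, Matrix (Fin (d f)) (Fin (d f)) ℂ) :
    Matrix (∀ f, Fin (d f)) (∀ f, Fin (d f)) ℂ := kron g

section Marginal

variable {F : Type*} [Fintype F] [DecidableEq F] {d : F → ℕ}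

/-- The operator acting as `X` on factor `f` and trivially on the others. -/
def at1 (f : F) (X : Matrix (Fin (d f)) (Fin (d f)) ℂ) :
    ∀ f, Matrix (Fin (d f)) (Fin (d f)) ℂ := Function.update (fun _ => 1) f X

/-- The one-body marginal on factor `f`. -/
def marg (f : F) (ψ : (∀ f, Fin (d f)) → ℂ) : Matrix (Fin (d f)) (Fin (d f)) ℂ :=
  Matrix.of fun i j => star ψ ⬝ᵥ (loc (at1 f (Matrix.single j i 1))).mulVec ψ

lemma loc_at1_add (f : F) (X Y : Matrix (Fin (d f)) (Fin (d f)) ℂ) :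
    loc (at1 f (X + Y)) = loc (at1 f X) + loc (at1 f Y) := by
  ext x y
  simp only [kron, Matrix.of_apply, Matrix.add_apply]
  rw [← Finset.mul_prod_erase _ _ (Finset.mem_univ f),
    ← Finset.mul_prod_erase _ _ (Finset.mem_univ f),
    ← Finset.mul_prod_erase _ _ (Finset.mem_univ f)]
  simp only [at1, Function.update_self, Matrix.add_apply, add_mul]
  congr 1 <;> congr 1 <;> refine Finset.prod_congr rfl fun g hg => ?_ <;>
    rw [Function.update_of_ne (Finset.ne_of_mem_erase hg),
      Function.update_of_ne (Finset.ne_of_mem_erase hg)]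

lemma loc_at1_smul (f : F) (r : ℂ) (X : Matrix (Fin (d f)) (Fin (d f)) ℂ) :
    loc (at1 f (r • X)) = r • loc (at1 f X) := by
  ext x y
  simp only [kron, Matrix.of_apply, Matrix.smul_apply]
  rw [← Finset.mul_prod_erase _ _ (Finset.mem_univ f),
    ← Finset.mul_prod_erase _ _ (Finset.mem_univ f)]
  simp only [at1, Function.update_self, Matrix.smul_apply, smul_eq_mul, mul_assoc]
  congr 2
  refine Finset.prod_congr rfl fun g hg => ?_
  rw [Function.update_of_ne (Finset.ne_of_mem_erase hg),
      Function.update_of_ne (Finset.ne_of_mem_erase hg)]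

/-- The expectation of a one-body operator, as a linear functional. -/
def expect (f : F) (ψ : (∀ f, Fin (d f)) → ℂ) : Matrix (Fin (d f)) (Fin (d f)) ℂ →ₗ[ℂ] ℂ where
  toFun X := star ψ ⬝ᵥ (loc (at1 f X)).mulVec ψ
  map_add' X Y := by rw [loc_at1_add, Matrix.add_mulVec, dotProduct_add]
  map_smul' r X := by rw [loc_at1_smul, Matrix.smul_mulVec, dotProduct_smul, RingHom.id_apply]

lemma expect_eq_trace (f : F) (ψ : (∀ f, Fin (d f)) → ℂ) (X : Matrix (Fin (d f)) (Fin (d f)) ℂ) :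
    star ψ ⬝ᵥ (loc (at1 f X)).mulVec ψ = (X * marg f ψ).trace := by
  change expect f ψ X = _
  conv_lhs => rw [Matrix.matrix_eq_sum_single X]
  simp only [map_sum, Matrix.trace, Matrix.diag_apply, Matrix.mul_apply]
  refine Finset.sum_congr rfl fun i _ => Finset.sum_congr rfl fun j _ => ?_
  have : Matrix.single i j (X i j) = X i j • Matrix.single i j (1 : ℂ) := by simp
  rw [this, map_smul]
  rfl

omit [Fintype F] in
lemma at1_conjTranspose (f : F) (X : Matrix (Fin (d f)) (Fin (d f)) ℂ) :
    (fun g => (at1 f X g).conjTranspose) = at1 f X.conjTranspose := by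
  ext1 g
  by_cases h : g = f
  · subst h; simp [at1]
  · simp [at1, h]

lemma nsq_loc_at1 (f : F) (ψ : (∀ f, Fin (d f)) → ℂ) (X : Matrix (Fin (d f)) (Fin (d f)) ℂ) :
    (nsq ((loc (at1 f X)).mulVec ψ) : ℂ) = (X.conjTranspose * X * marg f ψ).trace := by
  have h : (fun t => (at1 f X t).conjTranspose * at1 f X t) = at1 f (X.conjTranspose * X) := by
    ext1 g
    by_cases h : g = f
    · subst h; simp [at1]
    · simp [at1, h]
  rw [nsq_mulVec, ← expect_eq_trace, ← kron_conjTranspose, ← kron_mul, h]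

lemma trace_marg (f : F) (ψ : (∀ f, Fin (d f)) → ℂ) : (marg f ψ).trace = nsq ψ := by
  have h := expect_eq_trace f ψ 1
  rw [one_mul] at h
  rw [← h, ← dotProduct_star_self]
  have : at1 f (1 : Matrix (Fin (d f)) (Fin (d f)) ℂ) = fun _ => 1 := by simp [at1]
  rw [this, loc, kron_one, Matrix.one_mulVec]

lemma marg_isHermitian (f : F) (ψ : (∀ f, Fin (d f)) → ℂ) : (marg f ψ).IsHermitian := by
  ext i j
  simp only [marg, Matrix.conjTranspose_apply, Matrix.of_apply]
  rw [Matrix.star_dotProduct, Matrix.star_mulVec, ← kron_conjTranspose, at1_conjTranspose,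
    Matrix.conjTranspose_single, star_one, Matrix.dotProduct_mulVec, star_star]

lemma marg_loc {k : ∀ f, Matrix (Fin (d f)) (Fin (d f)) ℂ}
    (hk : ∀ f, (k f).conjTranspose * k f = 1) (f : F) (ψ : (∀ f, Fin (d f)) → ℂ) :
    marg f ((loc k).mulVec ψ) = k f * marg f ψ * (k f).conjTranspose := by
  ext i j
  have h : ∀ X : Matrix (Fin (d f)) (Fin (d f)) ℂ,
      (X * marg f ((loc k).mulVec ψ)).trace
        = (X * (k f * marg f ψ * (k f).conjTranspose)).trace := by
    intro X
    rw [← expect_eq_trace, Matrix.star_mulVec, ← Matrix.dotProduct_mulVec, Matrix.mulVec_mulVec,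
      Matrix.mulVec_mulVec, ← kron_conjTranspose, ← kron_mul, ← kron_mul]
    have : (fun t => (k t).conjTranspose * at1 f X t * k t)
        = at1 f ((k f).conjTranspose * X * k f) := by
      ext1 g
      by_cases h : g = f
      · subst h; simp [at1, mul_assoc]
      · simp [at1, h, hk]
    rw [this, expect_eq_trace, mul_assoc, mul_assoc, Matrix.trace_mul_comm, mul_assoc, mul_assoc]
  simpa [Matrix.trace_single_mul] using h (Matrix.single j i 1)

lemma marg_smul (f : F) (r : ℂ) (ψ : (∀ f, Fin (d f)) → ℂ) :
    marg f (r • ψ) = ((‖r‖ ^ 2 : ℝ) : ℂ) • marg f ψ := by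
  ext i j
  simp only [marg, Matrix.of_apply, Matrix.smul_apply, Matrix.mulVec_smul, dotProduct_smul,
    star_smul, smul_dotProduct, smul_eq_mul]
  rw [← mul_assoc]
  congr 1
  have := Complex.mul_conj' r
  simpa using this

lemma continuous_marg (f : F) : Continuous (marg f : ((∀ f, Fin (d f)) → ℂ) → _) := by
  refine continuous_matrix fun i j => ?_
  simp only [marg, Matrix.of_apply, dotProduct, Matrix.mulVec, Pi.star_apply]
  fun_prop

end Marginal

section Borel

open Filter Topology

variable {F : Type*} [Fintype F] {d : F → ℕ}

/-- A family of invertible lower triangular matrices. -/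
def IsLowerFamily (b : ∀ f, Matrix (Fin (d f)) (Fin (d f)) ℂ) : Prop :=
  ∀ f, (∀ i j, i < j → b f i j = 0) ∧ ∀ i, b f i i ≠ 0

/-- The squared modulus of the character of weight `lam` of the lower triangular group. -/
def chi (lam : ∀ f, Fin (d f) → ℝ) (b : ∀ f, Matrix (Fin (d f)) (Fin (d f)) ℂ) : ℝ :=
  ∏ f, ∏ i, (‖b f i i‖ ^ 2) ^ lam f i

omit [Fintype F] in
lemma IsLowerFamily.mul_apply_self {b b' : ∀ f, Matrix (Fin (d f)) (Fin (d f)) ℂ}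
    (hb : IsLowerFamily b)
    (hb' : IsLowerFamily b') (f : F) (i : Fin (d f)) : (b f * b' f) i i = b f i i * b' f i i := by
  rw [Matrix.mul_apply]
  refine Finset.sum_eq_single i (fun j _ hj => ?_) (by simp)
  rcases lt_or_gt_of_ne hj with h | h
  · rw [(hb' f).1 j i h, mul_zero]
  · rw [(hb f).1 i j h, zero_mul]

omit [Fintype F] in
lemma IsLowerFamily.mul {b b' : ∀ f, Matrix (Fin (d f)) (Fin (d f)) ℂ} (hb : IsLowerFamily b)
    (hb' : IsLowerFamily b') : IsLowerFamily fun f => b f * b' f := by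
  refine fun f => ⟨fun i j hij => ?_, fun i => ?_⟩
  · refine (Matrix.mul_apply ..).trans (Finset.sum_eq_zero fun l _ => ?_)
    rcases lt_or_ge i l with h | h
    · rw [(hb f).1 i l h, zero_mul]
    · rw [(hb' f).1 l j (h.trans_lt hij), mul_zero]
  · refine (hb.mul_apply_self hb' f i).trans_ne ?_
    exact mul_ne_zero ((hb f).2 i) ((hb' f).2 i)

omit [Fintype F] in
lemma isLowerFamily_one : IsLowerFamily (d := d) fun _ => 1 :=
  fun _ => ⟨fun _ _ h => Matrix.one_apply_ne h.ne, fun _ => by simp⟩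

lemma chi_mul (lam : ∀ f, Fin (d f) → ℝ) {b b' : ∀ f, Matrix (Fin (d f)) (Fin (d f)) ℂ}
    (hb : IsLowerFamily b) (hb' : IsLowerFamily b') :
    chi lam (fun f => b f * b' f) = chi lam b * chi lam b' := by
  simp only [chi, ← Finset.prod_mul_distrib]
  refine Finset.prod_congr rfl fun f _ => Finset.prod_congr rfl fun i _ => ?_
  rw [hb.mul_apply_self hb', norm_mul, mul_pow, Real.mul_rpow (sq_nonneg _) (sq_nonneg _)]

lemma chi_pos (lam : ∀ f, Fin (d f) → ℝ) {b : ∀ f, Matrix (Fin (d f)) (Fin (d f)) ℂ}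
    (hb : IsLowerFamily b) : 0 < chi lam b := by
  refine Finset.prod_pos fun f _ => Finset.prod_pos fun i _ => Real.rpow_pos_of_pos ?_ _
  have := norm_pos_iff.mpr ((hb f).2 i)
  positivity

lemma chi_convexComb (lam mu : ∀ f, Fin (d f) → ℝ) {s t : ℝ}
    {b : ∀ f, Matrix (Fin (d f)) (Fin (d f)) ℂ} (hb : IsLowerFamily b) :
    chi (s • lam + t • mu) b = chi lam b ^ s * chi mu b ^ t := by
  have h : ∀ f i, 0 < ‖b f i i‖ ^ 2 := fun f i => by
    have := norm_pos_iff.mpr ((hb f).2 i)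
    positivity
  have key : ∀ (r : ℝ) (nu : ∀ f, Fin (d f) → ℝ), chi nu b ^ r = chi (r • nu) b := by
    intro r nu
    simp only [chi]
    rw [← Real.finsetProd_rpow _ _ fun f _ => Finset.prod_nonneg fun i _ =>
      Real.rpow_nonneg (h f i).le _]
    refine Finset.prod_congr rfl fun f _ => ?_
    rw [← Real.finsetProd_rpow _ _ fun i _ => Real.rpow_nonneg (h f i).le _]
    refine Finset.prod_congr rfl fun i _ => ?_
    rw [← Real.rpow_mul (h f i).le, Pi.smul_apply, Pi.smul_apply, smul_eq_mul, mul_comm]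
  rw [key, key]
  simp only [chi, ← Finset.prod_mul_distrib, Pi.add_apply]
  refine Finset.prod_congr rfl fun f _ => Finset.prod_congr rfl fun i _ => ?_
  rw [Real.rpow_add (h f i)]

lemma continuous_chi {b : ∀ f, Matrix (Fin (d f)) (Fin (d f)) ℂ} (hb : IsLowerFamily b) :
    Continuous fun lam : ∀ f, Fin (d f) → ℝ => chi lam b := by
  unfold chi
  refine continuous_finsetProd _ fun f _ => continuous_finsetProd _ fun i _ => ?_
  have : ‖b f i i‖ ^ 2 ≠ 0 := pow_ne_zero _ (norm_ne_zero_iff.mpr ((hb f).2 i))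
  exact (Real.continuous_const_rpow this).comp (by fun_prop)

variable [DecidableEq F]

/-- A limit of unit vectors dominating characters up to factors tending to `1` dominates the
limiting character. -/
lemma exists_limit_dominating (φ : ℕ → (∀ f, Fin (d f)) → ℂ) (hφ : ∀ n, nsq (φ n) = 1)
    (lam : ℕ → ∀ f, Fin (d f) → ℝ) (C : ℝ) (hlam : ∀ n f i, |lam n f i| ≤ C)
    (c : ℕ → ℝ) (hc : Tendsto c atTop (𝓝 1))
    (h : ∀ n b, IsLowerFamily b → c n * chi (lam n) b ≤ nsq ((loc b).mulVec (φ n))) :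
    ∃ (φ' : (∀ f, Fin (d f)) → ℂ) (lam' : ∀ f, Fin (d f) → ℝ) (θ : ℕ → ℕ), StrictMono θ ∧
      Tendsto (φ ∘ θ) atTop (𝓝 φ') ∧ Tendsto (lam ∘ θ) atTop (𝓝 lam') ∧ nsq φ' = 1 ∧
      ∀ b, IsLowerFamily b → chi lam' b ≤ nsq ((loc b).mulVec φ') := by
  have hK : IsCompact {l : ∀ f, Fin (d f) → ℝ | ∀ f i, l f i ∈ Set.Icc (-C) C} := by
    have := isCompact_univ_pi fun f : F => isCompact_univ_pi fun _ : Fin (d f) =>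
      isCompact_Icc (a := -C) (b := C)
    have he : {l : ∀ f, Fin (d f) → ℝ | ∀ f i, l f i ∈ Set.Icc (-C) C}
        = Set.univ.pi fun f : F => Set.univ.pi fun _ : Fin (d f) => Set.Icc (-C) C := by
      ext l
      simp only [Set.mem_ofPred_eq, Set.mem_univ_pi]
    rwa [he]
  obtain ⟨⟨φ', lam'⟩, hmem, θ, hθ, hlim⟩ := (isCompact_nsq_eq_one.prod hK).tendsto_subseq
    (x := fun n => (φ n, lam n)) fun n => ⟨hφ n, fun f i => abs_le.mp (hlam n f i)⟩
  have h1 : Tendsto (φ ∘ θ) atTop (𝓝 φ') := (continuous_fst.tendsto _).comp hlim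
  have h2 : Tendsto (lam ∘ θ) atTop (𝓝 lam') := (continuous_snd.tendsto _).comp hlim
  refine ⟨φ', lam', θ, hθ, h1, h2, hmem.1, fun b hb => ?_⟩
  have hl : Tendsto (fun n => c (θ n) * chi (lam (θ n)) b) atTop (𝓝 (1 * chi lam' b)) :=
    (hc.comp hθ.tendsto_atTop).mul (((continuous_chi hb).tendsto _).comp h2)
  have hr : Tendsto (fun n => nsq ((loc b).mulVec (φ (θ n)))) atTop
      (𝓝 (nsq ((loc b).mulVec φ'))) :=
    ((continuous_nsq.comp (Continuous.matrix_mulVec continuous_const continuous_id)).tendsto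
      φ').comp h1
  rw [one_mul] at hl
  exact le_of_tendsto_of_tendsto' hl hr fun n => h _ b hb

lemma nsq_loc_at1_transvection (f : F) (φ : (∀ f, Fin (d f)) → ℂ) (i j : Fin (d f)) (s : ℂ) :
    nsq ((loc (at1 f (1 + s • Matrix.single i j 1))).mulVec φ)
      = nsq φ + 2 * (s * marg f φ j i).re + ‖s‖ ^ 2 * (marg f φ j j).re := by
  have h := nsq_loc_at1 f φ (1 + s • Matrix.single i j 1)
  have hij : marg f φ i j = star (marg f φ j i) := ((marg_isHermitian f φ).apply i j).symm
  have he : (1 + s • Matrix.single i j (1 : ℂ)).conjTranspose * (1 + s • Matrix.single i j 1)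
      = 1 + s • Matrix.single i j 1 + star s • Matrix.single j i 1
        + (star s * s) • Matrix.single j j 1 := by
    simp only [Matrix.conjTranspose_add, Matrix.conjTranspose_one, Matrix.conjTranspose_smul,
      Matrix.conjTranspose_single, star_one, mul_add, add_mul, one_mul, mul_one, smul_mul_assoc,
      mul_smul_comm, Matrix.single_mul_single_same, smul_add, smul_smul, mul_comm (star s) s]
    abel
  rw [he] at h
  simp only [add_mul, smul_mul_assoc, Matrix.trace_add, Matrix.trace_smul,
    Matrix.trace_single_mul, one_mul, trace_marg, smul_eq_mul, hij] at h
  have h' := congrArg Complex.re h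
  have hs : star s * s = ((‖s‖ ^ 2 : ℝ) : ℂ) := by simpa using Complex.conj_mul' s
  rw [hs] at h'
  simp only [Complex.ofReal_re, Complex.add_re, Complex.re_ofReal_mul] at h'
  rw [h']
  simp
  ring

/-- A unit vector whose orbit under the lower triangular group dominates the character of weight
`lam` has diagonal marginals `lam`. -/
lemma marg_eq_diagonal {φ : (∀ f, Fin (d f)) → ℂ} (hφ : nsq φ = 1) {lam : ∀ f, Fin (d f) → ℝ}
    (h : ∀ b, IsLowerFamily b → chi lam b ≤ nsq ((loc b).mulVec φ)) (f : F) :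
    marg f φ = Matrix.diagonal fun i => (lam f i : ℂ) := by
  have hlow : ∀ (i j : Fin (d f)) (s : ℂ), j ≤ i → (i = j → 1 + s ≠ 0) →
      IsLowerFamily (at1 (d := d) f (1 + s • Matrix.single i j 1)) := by
    intro i j s hji hs g
    by_cases hg : g = f
    · subst hg
      simp only [at1, Function.update_self]
      refine ⟨fun p q hpq => ?_, fun p => ?_⟩
      · have : ¬ (i = p ∧ j = q) := by rintro ⟨rfl, rfl⟩; exact absurd hpq (not_lt.mpr hji)
        simp [Matrix.one_apply_ne hpq.ne, this]
      · by_cases hp : i = p ∧ j = p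
        · obtain ⟨rfl, rfl⟩ := hp
          simpa using hs rfl
        · simp [hp]
    · simp only [at1, Function.update_of_ne hg]
      exact isLowerFamily_one g
  have hlt : ∀ i j, j < i → marg f φ j i = 0 := by
    intro i j hji
    by_contra hne
    have hchi : ∀ s : ℂ, chi lam (at1 f (1 + s • Matrix.single i j 1)) = 1 := by
      intro s
      refine Finset.prod_eq_one fun g _ => Finset.prod_eq_one fun p _ => ?_
      by_cases hg : g = f
      · subst hg
        have : ¬ (i = p ∧ j = p) := by rintro ⟨rfl, rfl⟩; exact lt_irrefl _ hji
        simp [at1, this]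
      · simp [at1, Function.update_of_ne hg]
    set r := (marg f φ j j).re
    set ρ := marg f φ j i
    have hρ : 0 < ‖ρ‖ ^ 2 := by positivity
    set t : ℝ := (1 + |r|)⁻¹
    have ht : 0 < t := by positivity
    have htr : t * r < 1 := by
      have : t * (1 + |r|) = 1 := inv_mul_cancel₀ (by positivity)
      nlinarith [le_abs_self r]
    have h0 := h _ (hlow i j (-(t : ℂ) * star ρ) hji.le fun e => absurd e hji.ne')
    rw [hchi, nsq_loc_at1_transvection, hφ] at h0
    have e1 : (-(t : ℂ) * star ρ * ρ).re = -t * ‖ρ‖ ^ 2 := by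
      have : star ρ * ρ = ((‖ρ‖ ^ 2 : ℝ) : ℂ) := by simpa using Complex.conj_mul' ρ
      rw [mul_assoc, this, ← Complex.ofReal_neg, ← Complex.ofReal_mul, Complex.ofReal_re]
    have e2 : ‖-(t : ℂ) * star ρ‖ ^ 2 = t ^ 2 * ‖ρ‖ ^ 2 := by
      rw [norm_mul, mul_pow, norm_neg, norm_star, Complex.norm_real, Real.norm_eq_abs, sq_abs]
    rw [e1, e2] at h0
    have : t * ‖ρ‖ ^ 2 * (2 - t * r) ≤ 0 := by
      change _ ≤ 1 + _ + _ * r at h0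
      nlinarith
    have h3 : 0 < t * ‖ρ‖ ^ 2 * (2 - t * r) := by
      have : 0 < 2 - t * r := by linarith
      positivity
    linarith
  ext i j
  rcases lt_trichotomy i j with hij | rfl | hij
  · rw [hlt j i hij, Matrix.diagonal_apply_ne _ hij.ne]
  · rw [Matrix.diagonal_apply_eq]
    have hre : (marg f φ i i).re = lam f i := by
      set r := (marg f φ i i).re with hr
      let g : ℝ → ℝ := fun t => 1 + (Real.exp (2 * t) - 1) * r - Real.exp (2 * t * lam f i)
      have hg : ∀ t, 0 ≤ g t := by
        intro t
        have h0 := h _ (hlow i i ((Real.exp t - 1 : ℝ) : ℂ) le_rfl fun _ => by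
          push_cast; rw [add_sub_cancel]; exact_mod_cast (Real.exp_pos t).ne')
        have hchi : chi lam (at1 f (1 + ((Real.exp t - 1 : ℝ) : ℂ) • Matrix.single i i 1))
            = Real.exp (2 * t * lam f i) := by
          rw [chi, Finset.prod_eq_single f, Finset.prod_eq_single i]
          · simp only [at1, Function.update_self, Matrix.add_apply, Matrix.one_apply_eq,
              Matrix.smul_apply, Matrix.single_apply_same, smul_eq_mul, mul_one]
            have : (1 : ℂ) + ((Real.exp t - 1 : ℝ) : ℂ) = (Real.exp t : ℝ) := by push_cast; ring
            rw [this, Complex.norm_real, Real.norm_eq_abs, abs_of_pos (Real.exp_pos t),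
              ← Real.exp_nat_mul, ← Real.exp_mul]
            norm_num
          · intro p _ hp
            simp [at1, hp.symm]
          · simp
          · intro g _ hg
            simp [at1, Function.update_of_ne hg]
          · simp
        rw [hchi, nsq_loc_at1_transvection, hφ, Complex.re_ofReal_mul, Complex.norm_real,
          Real.norm_eq_abs, sq_abs, ← hr] at h0
        have : Real.exp (2 * t) = Real.exp t ^ 2 := by rw [← Real.exp_nat_mul]; norm_num
        simp only [g]
        rw [this]
        nlinarith
      have hmin : IsLocalMin g 0 := Filter.Eventually.of_forall fun t => by
        have : g 0 = 0 := by simp [g]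
        rw [this]; exact hg t
      have hder : HasDerivAt g (2 * r - 2 * lam f i) 0 := by
        have h1 : HasDerivAt (fun t : ℝ => Real.exp (2 * t)) 2 0 := by
          have := ((hasDerivAt_id (0 : ℝ)).const_mul 2).exp
          simpa using this
        have h2 : HasDerivAt (fun t : ℝ => Real.exp (2 * t * lam f i)) (2 * lam f i) 0 := by
          have := (((hasDerivAt_id (0 : ℝ)).const_mul 2).mul_const (lam f i)).exp
          simpa using this
        exact (((h1.sub_const 1).mul_const r).const_add 1).sub h2
      have := hmin.hasDerivAt_eq_zero hder
      linarith
    have him : (marg f φ i i).im = 0 := by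
      have := congrArg Complex.im ((marg_isHermitian f φ).apply i i)
      simp at this
      linarith
    exact Complex.ext (by simpa using hre) (by simpa using him)
  · rw [Matrix.diagonal_apply_ne _ hij.ne', ← (marg_isHermitian f φ).apply, hlt i j hij, star_zero]

/-- If the orbit of `ψ` under the lower triangular group dominates a positive multiple of the
character of weight `lam`, then `lam` is attained by diagonal marginals of some unit vector. -/
lemma exists_marg_eq_diagonal {ψ : (∀ f, Fin (d f)) → ℂ} {lam : ∀ f, Fin (d f) → ℝ} {c : ℝ}
    (hc : 0 < c) (h : ∀ b, IsLowerFamily b → c * chi lam b ≤ nsq ((loc b).mulVec ψ)) :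
    ∃ φ : (∀ f, Fin (d f)) → ℂ, nsq φ = 1 ∧
      ∀ f, marg f φ = Matrix.diagonal fun i => (lam f i : ℂ) := by
  let S : Set ℝ := {r | ∃ b, IsLowerFamily b ∧ r = nsq ((loc b).mulVec ψ) / chi lam b}
  have hS : S.Nonempty := ⟨_, _, isLowerFamily_one, rfl⟩
  have hlb : ∀ r ∈ S, c ≤ r := by
    rintro _ ⟨b, hb, rfl⟩
    rw [le_div_iff₀ (chi_pos lam hb)]
    exact h b hb
  have hbdd : BddBelow S := ⟨c, hlb⟩
  have hpos : 0 < sInf S := hc.trans_le (le_csInf hS hlb)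
  obtain ⟨u, -, hu, huS⟩ := exists_seq_tendsto_sInf hS hbdd
  choose b hb hub using huS
  have hn : ∀ n, 0 < nsq ((loc (b n)).mulVec ψ) := fun n =>
    (mul_pos hc (chi_pos lam (hb n))).trans_le (h _ (hb n))
  let φ : ℕ → (∀ f, Fin (d f)) → ℂ := fun n =>
    (((√(nsq ((loc (b n)).mulVec ψ)))⁻¹ : ℝ) : ℂ) • (loc (b n)).mulVec ψ
  have hscale : ∀ n, ‖(((√(nsq ((loc (b n)).mulVec ψ)))⁻¹ : ℝ) : ℂ)‖ ^ 2
      = (nsq ((loc (b n)).mulVec ψ))⁻¹ := by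
    intro n
    rw [Complex.norm_real, Real.norm_eq_abs, sq_abs, inv_pow, Real.sq_sqrt (hn n).le]
  obtain ⟨φ', lam', θ, -, -, hlam', hφ', hdom⟩ := exists_limit_dominating φ
    (fun n => by rw [nsq_smul, hscale, inv_mul_cancel₀ (hn n).ne'])
    (fun _ => lam) (∑ f, ∑ i, |lam f i|)
    (fun _ f i => (Finset.single_le_sum (f := fun i => |lam f i|) (fun _ _ => abs_nonneg _)
      (Finset.mem_univ i)).trans (Finset.single_le_sum (f := fun f => ∑ i, |lam f i|)
        (fun _ _ => Finset.sum_nonneg fun _ _ => abs_nonneg _) (Finset.mem_univ f)))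
    (fun n => sInf S / u n) (by
      have := (tendsto_const_nhds (x := sInf S)).div hu hpos.ne'
      rwa [div_self hpos.ne'] at this) (by
      intro n b' hb'
      have hmem :
          nsq ((loc fun f => b' f * b n f).mulVec ψ) / chi lam (fun f => b' f * b n f) ∈ S :=
        ⟨_, hb'.mul (hb n), rfl⟩
      have h1 := csInf_le hbdd hmem
      rw [le_div_iff₀ (chi_pos lam (hb'.mul (hb n))), chi_mul lam hb' (hb n), loc, kron_mul,
        ← Matrix.mulVec_mulVec] at h1
      rw [Matrix.mulVec_smul, nsq_smul, hscale, hub]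
      have := chi_pos lam (hb n)
      rw [div_div_eq_mul_div, div_mul_eq_mul_div, inv_mul_eq_div]
      exact div_le_div_of_nonneg_right (by linarith) (hn n).le)
  have : lam' = lam := tendsto_nhds_unique hlam' tendsto_const_nhds
  subst this
  exact ⟨φ', hφ', marg_eq_diagonal hφ' hdom⟩

end Borel

section WeightProjection

variable {X P : Type*} [Fintype X]

lemma ite_eq_mem_of_circle_stable {E : Submodule ℂ (X → ℂ)} (w : X → ℕ)
    (hE : ∀ z : ℂ, ‖z‖ = 1 → ∀ v ∈ E, (fun x => z ^ w x * v x) ∈ E) {v : X → ℂ} (hv : v ∈ E)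
    (j : ℕ) : (fun x => if w x = j then v x else 0) ∈ E := by
  classical
  by_contra hj
  obtain ⟨l, hl, hEl⟩ := Submodule.exists_le_ker_of_notMem hj
  have key : ∀ g : X → ℂ, l (fun x => g x * v x) = ∑ x, g x * l (Pi.single x (v x)) := by
    intro g
    have : (fun x => g x * v x) = ∑ x, g x • (Pi.single x (v x) : X → ℂ) := by
      ext y
      simp [Finset.sum_apply, Pi.single_apply]
    rw [this, map_sum]
    simp
  let p : Polynomial ℂ := ∑ x, Polynomial.C (l (Pi.single x (v x))) * Polynomial.X ^ w x
  have hp : p = 0 := by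
    refine Polynomial.eq_zero_of_infinite_isRoot p
      (Set.Infinite.mono (s := Metric.sphere 0 1) ?_ ?_)
    · intro z hz
      have h0 := hEl (hE z (by simpa using hz) v hv)
      rw [LinearMap.mem_ker, key] at h0
      show p.eval z = 0
      simp only [p, Polynomial.eval_finsetSum, Polynomial.eval_mul, Polynomial.eval_C,
        Polynomial.eval_pow, Polynomial.eval_X]
      rw [← h0]
      exact Finset.sum_congr rfl fun x _ => mul_comm _ _
    · refine (isPreconnected_sphere (by simp) _ _).infinite_of_nontrivial ?_
      exact ⟨1, by simp, -1, by simp, by norm_num⟩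
  apply hl
  have h1 : (fun x => if w x = j then v x else 0) =
      fun x => (if w x = j then (1 : ℂ) else 0) * v x := by
    ext x; split_ifs <;> simp
  have h2 := congrArg (fun q => Polynomial.coeff q j) hp
  simp only [p, Polynomial.finsetSum_coeff, Polynomial.coeff_C_mul, Polynomial.coeff_X_pow,
    Polynomial.coeff_zero] at h2
  rw [h1, key]
  refine Eq.trans (Finset.sum_congr rfl fun x _ => ?_) h2
  rw [mul_comm]
  simp only [eq_comm]

lemma comp_mul_mem_of_torus_stable [Fintype P] {E : Submodule ℂ (X → ℂ)} (w : X → P → ℕ)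
    (hE : ∀ p, ∀ z : ℂ, ‖z‖ = 1 → ∀ v ∈ E, (fun x => z ^ w x p * v x) ∈ E)
    (g : (P → ℕ) → ℂ) {v : X → ℂ} (hv : v ∈ E) : (fun x => g (w x) * v x) ∈ E := by
  classical
  have proj : ∀ (S : Finset P) (m : P → ℕ),
      (fun x => if ∀ p ∈ S, w x p = m p then v x else 0) ∈ E := by
    intro S m
    induction S using Finset.induction_on with
    | empty => simpa using hv
    | insert p S _ ih =>
      convert ite_eq_mem_of_circle_stable (fun x => w x p) (hE p) ih (m p) using 2 with x
      simp only [Finset.forall_mem_insert]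
      split_ifs <;> simp_all
  have hsum : (fun x => g (w x) * v x) = ∑ m ∈ Finset.univ.image w,
      g m • fun x => if ∀ p ∈ (Finset.univ : Finset P), w x p = m p then v x else 0 := by
    ext x
    rw [Finset.sum_apply, Finset.sum_eq_single (w x)]
    · simp
    · intro m _ hm
      have : ¬ ∀ p ∈ (Finset.univ : Finset P), w x p = m p := fun h =>
        hm (funext fun p => (h p (Finset.mem_univ p)).symm)
      simp only [Pi.smul_apply, if_neg this, smul_zero]
    · intro h
      exact absurd (Finset.mem_image_of_mem w (Finset.mem_univ x)) h
  rw [hsum]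
  exact E.sum_mem fun m _ => E.smul_mem _ (proj _ m)

end WeightProjection

open scoped ComplexOrder in
lemma exists_eq_unitary_mul_diagonal_mul_unitary {n : ℕ} {g : Matrix (Fin n) (Fin n) ℂ}
    (hg : IsUnit g) : ∃ (k₁ k₂ : Matrix (Fin n) (Fin n) ℂ) (D : Fin n → ℂ),
      k₁.conjTranspose * k₁ = 1 ∧ k₂.conjTranspose * k₂ = 1 ∧ g = k₁ * Matrix.diagonal D * k₂ := by
  have hpd : (g.conjTranspose * g).PosDef :=
    Matrix.PosDef.conjTranspose_mul_self g (Matrix.mulVec_injective_of_isUnit hg)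
  have hH := hpd.isHermitian
  set U : Matrix (Fin n) (Fin n) ℂ := (hH.eigenvectorUnitary : Matrix (Fin n) (Fin n) ℂ) with hU
  have hU1 : U.conjTranspose * U = 1 := by
    have := Unitary.star_mul_self_of_mem hH.eigenvectorUnitary.2
    simpa [Matrix.star_eq_conjTranspose] using this
  have hU2 : U * U.conjTranspose = 1 := by
    have := Unitary.mul_star_self_of_mem hH.eigenvectorUnitary.2
    simpa [Matrix.star_eq_conjTranspose] using this
  set e := hH.eigenvalues with he
  have hpos : ∀ i, 0 < e i := fun i => hpd.eigenvalues_pos i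
  have hspec : g.conjTranspose * g =
      U * Matrix.diagonal (fun i => (e i : ℂ)) * U.conjTranspose := by
    have := hH.spectral_theorem
    rw [Unitary.conjStarAlgAut_apply] at this
    simpa [Matrix.star_eq_conjTranspose, Function.comp_def] using this
  have hs : ∀ i, ((Real.sqrt (e i))⁻¹ : ℂ) * e i * ((Real.sqrt (e i))⁻¹ : ℂ) = 1 := by
    intro i
    have h0 : (Real.sqrt (e i)) ≠ 0 := (Real.sqrt_pos.mpr (hpos i)).ne'
    have h1 : Real.sqrt (e i) * Real.sqrt (e i) = e i := Real.mul_self_sqrt (hpos i).le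
    have h2 : ((Real.sqrt (e i))⁻¹ : ℝ) * e i * (Real.sqrt (e i))⁻¹ = 1 := by
      field_simp; rw [pow_two, h1]
    exact_mod_cast h2
  refine ⟨g * U * Matrix.diagonal fun i => ((Real.sqrt (e i))⁻¹ : ℂ), U.conjTranspose,
    fun i => (Real.sqrt (e i) : ℂ), ?_, ?_, ?_⟩
  · rw [Matrix.conjTranspose_mul, Matrix.conjTranspose_mul, Matrix.diagonal_conjTranspose]
    calc _ = Matrix.diagonal (star fun i => ((Real.sqrt (e i))⁻¹ : ℂ)) *
        (U.conjTranspose * (g.conjTranspose * g) * U) *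
          Matrix.diagonal (fun i => ((Real.sqrt (e i))⁻¹ : ℂ)) := by simp only [Matrix.mul_assoc]
      _ = Matrix.diagonal (star fun i => ((Real.sqrt (e i))⁻¹ : ℂ)) *
          ((U.conjTranspose * U) * Matrix.diagonal (fun i => (e i : ℂ)) * (U.conjTranspose * U)) *
          Matrix.diagonal (fun i => ((Real.sqrt (e i))⁻¹ : ℂ)) := by
        rw [hspec]; simp only [Matrix.mul_assoc]
      _ = 1 := by
        rw [hU1, Matrix.one_mul, Matrix.mul_one, Matrix.diagonal_mul_diagonal,
          Matrix.diagonal_mul_diagonal, ← Matrix.diagonal_one]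
        congr 1
        ext i
        simpa using hs i
  · rw [Matrix.conjTranspose_conjTranspose, hU2]
  · rw [Matrix.mul_assoc (g * U), Matrix.diagonal_mul_diagonal]
    have : (fun i => ((Real.sqrt (e i))⁻¹ : ℂ) * (Real.sqrt (e i) : ℂ)) = fun _ => 1 := by
      ext i
      refine inv_mul_cancel₀ ?_
      exact_mod_cast (Real.sqrt_pos.mpr (hpos i)).ne'
    rw [this, Matrix.diagonal_one, Matrix.mul_one, Matrix.mul_assoc, hU2, Matrix.mul_one]

section HighestWeight

variable {F : Type*} [Fintype F] {d : F → ℕ}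

/-- The diagonal action of a local operator on the `N`-th tensor power. -/
abbrev locPow (N : ℕ) (g : ∀ f, Matrix (Fin (d f)) (Fin (d f)) ℂ) :
    Matrix (Fin N → ∀ f, Fin (d f)) (Fin N → ∀ f, Fin (d f)) ℂ := kron fun _ => loc g

/-- The weight of a basis vector of the `N`-th tensor power. -/
def weight {N : ℕ} (x : Fin N → ∀ f, Fin (d f)) (p : Σ f, Fin (d f)) : ℕ :=
  (Finset.univ.filter fun t => x t p.1 = p.2).card

variable {N : ℕ}

lemma prod_prod_eq_prod_pow_weight (D : ∀ f, Fin (d f) → ℂ) (x : Fin N → ∀ f, Fin (d f)) :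
    ∏ t, ∏ f, D f (x t f) = ∏ f, ∏ i, D f i ^ weight x ⟨f, i⟩ := by
  rw [Finset.prod_comm]
  refine Finset.prod_congr rfl fun f _ => ?_
  rw [← Finset.prod_fiberwise' Finset.univ (fun t => x t f) (D f)]
  exact Finset.prod_congr rfl fun i _ => Finset.prod_const _

omit [Fintype F] in
lemma sum_weight_mul (h : ∀ f, Fin (d f) → ℕ) (x : Fin N → ∀ f, Fin (d f)) (f : F) :
    ∑ i, weight x ⟨f, i⟩ * h f i = ∑ t, h f (x t f) := by
  rw [← Finset.sum_fiberwise' Finset.univ (fun t => x t f) (h f)]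
  refine Finset.sum_congr rfl fun i _ => ?_
  rw [Finset.sum_const, smul_eq_mul, weight]

omit [Fintype F] in
lemma sum_weight (x : Fin N → ∀ f, Fin (d f)) (f : F) : ∑ i, weight x ⟨f, i⟩ = N := by
  simpa using sum_weight_mul (fun _ _ => 1) x f

lemma locPow_diagonal_mulVec [DecidableEq F] (D : ∀ f, Fin (d f) → ℂ)
    (v : (Fin N → ∀ f, Fin (d f)) → ℂ) :
    (locPow N fun f => Matrix.diagonal (D f)).mulVec v =
      fun x => (∏ f, ∏ i, D f i ^ weight x ⟨f, i⟩) * v x := by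
  ext x
  rw [locPow, loc, kron_diagonal, kron_diagonal, Matrix.mulVec_diagonal,
    prod_prod_eq_prod_pow_weight]

lemma locPow_mul [DecidableEq F] (g h : ∀ f, Matrix (Fin (d f)) (Fin (d f)) ℂ) :
    locPow N (fun f => g f * h f) = locPow N g * locPow N h := by
  rw [locPow, loc, kron_mul, kron_mul]

lemma locPow_conjTranspose (g : ∀ f, Matrix (Fin (d f)) (Fin (d f)) ℂ) :
    locPow N (fun f => (g f).conjTranspose) = (locPow N g).conjTranspose := by
  rw [locPow, loc, kron_conjTranspose, kron_conjTranspose]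

lemma locPow_one : locPow N (fun f => (1 : Matrix (Fin (d f)) (Fin (d f)) ℂ)) = 1 := by
  rw [locPow, loc, kron_one, kron_one]

/-- Stability under the diagonal action of the local unitary group. -/
def IsUnitaryStable [DecidableEq F] (E : Submodule ℂ ((Fin N → ∀ f, Fin (d f)) → ℂ)) : Prop :=
  ∀ k : ∀ f, Matrix (Fin (d f)) (Fin (d f)) ℂ, (∀ f, (k f).conjTranspose * k f = 1) →
    ∀ v ∈ E, (locPow N k).mulVec v ∈ E

lemma IsUnitaryStable.comp_weight_mul_mem [DecidableEq F]
    {E : Submodule ℂ ((Fin N → ∀ f, Fin (d f)) → ℂ)}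
    (hE : IsUnitaryStable E) (g : ((Σ f, Fin (d f)) → ℕ) → ℂ)
    {v : (Fin N → ∀ f, Fin (d f)) → ℂ} (hv : v ∈ E) : (fun x => g (weight x) * v x) ∈ E := by
  refine comp_mul_mem_of_torus_stable weight (fun p z hz v hv => ?_) g hv
  let D : ∀ f, Fin (d f) → ℂ := fun f i => if (⟨f, i⟩ : Σ f, Fin (d f)) = p then z else 1
  have h := hE (fun f => Matrix.diagonal (D f)) (fun f => ?_) v hv
  · convert h using 1
    rw [locPow_diagonal_mulVec]
    ext x
    rw [← Fintype.prod_sigma' (f := fun f i => D f i ^ weight x ⟨f, i⟩),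
      Finset.prod_eq_single p]
    · simp [D]
    · intro q _ hq
      simp [D, hq]
    · simp
  · rw [Matrix.diagonal_conjTranspose, Matrix.diagonal_mul_diagonal, ← Matrix.diagonal_one]
    congr 1
    ext i
    have hz' : (starRingEnd ℂ) z * z = 1 := by rw [mul_comm, Complex.mul_conj', hz]; simp
    simp only [D, Pi.star_apply]
    split_ifs
    · exact hz'
    · simp

lemma IsUnitaryStable.locPow_mulVec_mem [DecidableEq F]
    {E : Submodule ℂ ((Fin N → ∀ f, Fin (d f)) → ℂ)}
    (hE : IsUnitaryStable E) {g : ∀ f, Matrix (Fin (d f)) (Fin (d f)) ℂ} (hg : ∀ f, IsUnit (g f))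
    {v : (Fin N → ∀ f, Fin (d f)) → ℂ} (hv : v ∈ E) : (locPow N g).mulVec v ∈ E := by
  choose k₁ k₂ D h₁ h₂ h using fun f => exists_eq_unitary_mul_diagonal_mul_unitary (hg f)
  rw [show g = fun f => k₁ f * Matrix.diagonal (D f) * k₂ f from funext h, locPow_mul, locPow_mul,
    ← Matrix.mulVec_mulVec, ← Matrix.mulVec_mulVec]
  refine hE _ h₁ _ ?_
  rw [locPow_diagonal_mulVec]
  exact hE.comp_weight_mul_mem (fun m => ∏ f, ∏ i, D f i ^ m ⟨f, i⟩) (hE _ h₂ _ hv)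

/-- The total height of a weight. -/
def depth (m : (Σ f, Fin (d f)) → ℕ) : ℕ := ∑ f, ∑ i, m ⟨f, i⟩ * (i : ℕ)

lemma depth_weight (x : Fin N → ∀ f, Fin (d f)) : depth (weight x) = ∑ f, ∑ t, (x t f : ℕ) :=
  Finset.sum_congr rfl fun f _ => sum_weight_mul (fun _ i => (i : ℕ)) x f

lemma locPow_conjTranspose_apply_eq_zero {b : ∀ f, Matrix (Fin (d f)) (Fin (d f)) ℂ}
    (hb : IsLowerFamily b) {x y : Fin N → ∀ f, Fin (d f)} {t : Fin N} {f : F}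
    (h : y t f < x t f) : locPow N (fun f => (b f).conjTranspose) x y = 0 := by
  refine Finset.prod_eq_zero (Finset.mem_univ t) (Finset.prod_eq_zero (Finset.mem_univ f) ?_)
  show star (b f (y t f) (x t f)) = 0
  rw [(hb f).1 _ _ h, star_zero]

lemma depth_weight_lt {x y : Fin N → ∀ f, Fin (d f)} (h : ∀ t f, x t f ≤ y t f) (hxy : x ≠ y) :
    depth (weight x) < depth (weight y) := by
  obtain ⟨t, ht⟩ := Function.ne_iff.mp hxy
  obtain ⟨f, hf⟩ := Function.ne_iff.mp ht
  rw [depth_weight, depth_weight]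
  refine Finset.sum_lt_sum (fun g _ => Finset.sum_le_sum fun s _ => h s g)
    ⟨f, Finset.mem_univ f, Finset.sum_lt_sum (fun s _ => h s f) ⟨t, Finset.mem_univ t, ?_⟩⟩
  exact lt_of_le_of_ne (h t f) fun hh => hf (Fin.ext hh)

lemma sum_swap_mul_lt {n : ℕ} (m : Fin n → ℕ) {i j : Fin n} (hij : i < j) (hm : m i < m j) :
    ∑ l, m (Equiv.swap i j l) * (l : ℕ) < ∑ l, m l * (l : ℕ) := by
  zify
  rw [← sub_pos, ← Finset.sum_sub_distrib, Fintype.sum_eq_add i j hij.ne]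
  · simp only [Equiv.swap_apply_left, Equiv.swap_apply_right]
    have h1 : (i : ℤ) < j := by exact_mod_cast hij
    have h2 : (m i : ℤ) < m j := by exact_mod_cast hm
    nlinarith [mul_pos (sub_pos.mpr h1) (sub_pos.mpr h2)]
  · rintro l ⟨hi, hj⟩
    rw [Equiv.swap_apply_of_ne_of_ne hi hj, sub_self]

lemma locPow_perm_mulVec [DecidableEq F] (e : ∀ f, Equiv.Perm (Fin (d f)))
    (v : (Fin N → ∀ f, Fin (d f)) → ℂ) (x : Fin N → ∀ f, Fin (d f)) :
    (locPow N fun f => Matrix.of fun i j => if e f i = j then (1 : ℂ) else 0).mulVec v x =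
      v fun t f => e f (x t f) := by
  rw [Matrix.mulVec, dotProduct, Finset.sum_eq_single fun t f => e f (x t f)]
  · simp [kron]
  · intro y _ hy
    obtain ⟨t, ht⟩ := Function.ne_iff.mp hy
    obtain ⟨f, hf⟩ := Function.ne_iff.mp ht
    refine mul_eq_zero_of_left ?_ _
    exact Finset.prod_eq_zero (Finset.mem_univ t)
      (Finset.prod_eq_zero (Finset.mem_univ f) (if_neg (Ne.symm hf)))
  · simp

lemma exists_highestWeight [DecidableEq F] {E : Submodule ℂ ((Fin N → ∀ f, Fin (d f)) → ℂ)}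
    (hE : IsUnitaryStable E) (hE0 : E ≠ ⊥) :
    ∃ v ∈ E, v ≠ 0 ∧ ∃ m : ∀ f, Fin (d f) → ℕ, (∀ f, Antitone (m f)) ∧ (∀ f, ∑ i, m f i = N) ∧
      ∀ b, IsLowerFamily b → (locPow N fun f => (b f).conjTranspose).mulVec v =
        (∏ f, ∏ i, star (b f i i) ^ m f i) • v := by
  classical
  have hproj : ∀ w ∈ E, ∀ x, w x ≠ 0 → ∃ v ∈ E, v x ≠ 0 ∧ ∀ y, weight y ≠ weight x → v y = 0 := by
    intro w hw x hx
    refine ⟨_, hE.comp_weight_mul_mem (fun m => if m = weight x then 1 else 0) hw, ?_, ?_⟩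
    · simpa using hx
    · intro y hy
      simp [hy]
  let Q : ℕ → Prop := fun n => ∃ v ∈ E, ∃ x, v x ≠ 0 ∧ depth (weight x) = n ∧
    ∀ y, weight y ≠ weight x → v y = 0
  have hQ : ∃ n, Q n := by
    obtain ⟨w, hw, hw0⟩ := Submodule.exists_mem_ne_zero_of_ne_bot hE0
    obtain ⟨x, hx⟩ := Function.ne_iff.mp hw0
    obtain ⟨v, hv, hvx, h⟩ := hproj w hw x hx
    exact ⟨_, v, hv, x, hvx, rfl, h⟩
  obtain ⟨v, hv, x₀, hvx, hdepth, hsupp⟩ := Nat.find_spec hQ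
  have hmin : ∀ w ∈ E, ∀ x, depth (weight x) < depth (weight x₀) → w x = 0 := by
    intro w hw x hlt
    by_contra hx
    obtain ⟨v', hv', hvx', h⟩ := hproj w hw x hx
    exact Nat.find_min hQ (hdepth ▸ hlt) ⟨v', hv', x, hvx', rfl, h⟩
  refine ⟨v, hv, fun h => hvx (by rw [h]; rfl), fun f i => weight x₀ ⟨f, i⟩, ?_,
    fun f => sum_weight x₀ f, ?_⟩
  · intro f
    refine antitone_iff_forall_lt.mpr fun i j hij => ?_
    by_contra! hlt
    let e : ∀ f, Equiv.Perm (Fin (d f)) := Function.update (fun _ => 1) f (Equiv.swap i j)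
    have hee : ∀ g l, e g (e g l) = l := by
      intro g l
      by_cases hg : g = f
      · subst hg
        simp [e]
      · simp [e, hg]
    have hmem := hE (fun f => Matrix.of fun i j => if e f i = j then (1 : ℂ) else 0) (fun g => by
      ext p q
      simp only [Matrix.mul_apply, Matrix.conjTranspose_apply, Matrix.of_apply, Matrix.one_apply]
      rw [Finset.sum_eq_single (e g p)]
      · simp [hee]
      · intro l _ hl
        rw [if_neg, star_zero, zero_mul]
        rintro rfl
        exact hl (hee g l).symm
      · simp) v hv
    have h0 := hmin _ hmem (fun t f => e f (x₀ t f)) (Finset.sum_lt_sum (fun g _ => ?_)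
      ⟨f, Finset.mem_univ f, ?_⟩)
    · rw [locPow_perm_mulVec] at h0
      simp only [hee] at h0
      exact hvx h0
    all_goals
      have hw : ∀ g l, weight (fun t f => e f (x₀ t f)) ⟨g, l⟩ = weight x₀ ⟨g, e g l⟩ := by
        intro g l
        simp only [weight]
        congr 2
        ext t
        exact ⟨fun h => by rw [← h, hee], fun h => by rw [h, hee]⟩
      simp only [hw]
    · by_cases hg : g = f
      · subst hg
        simp only [e, Function.update_self]
        exact (sum_swap_mul_lt (fun l => weight x₀ ⟨g, l⟩) hij hlt).le
      · simp [e, hg]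
    · simp only [e, Function.update_self]
      exact sum_swap_mul_lt (fun l => weight x₀ ⟨f, l⟩) hij hlt
  · intro b hb
    have hunit : ∀ f, IsUnit (b f).conjTranspose := by
      intro f
      rw [Matrix.isUnit_iff_isUnit_det, Matrix.det_conjTranspose,
        Matrix.det_of_isLowerTriangular (b f) fun i j h => (hb f).1 i j h, isUnit_iff_ne_zero,
        star_ne_zero]
      exact Finset.prod_ne_zero_iff.mpr fun i _ => (hb f).2 i
    have hmem := hE.locPow_mulVec_mem hunit hv
    ext x
    rcases lt_or_ge (depth (weight x)) (depth (weight x₀)) with h | h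
    · rw [hmin _ hmem x h, Pi.smul_apply, hmin _ hv x h, smul_zero]
    · rw [Matrix.mulVec, dotProduct, Finset.sum_eq_single x]
      · by_cases hx : weight x = weight x₀
        · rw [Pi.smul_apply, smul_eq_mul, ← hx,
            ← prod_prod_eq_prod_pow_weight fun f i => star (b f i i)]
          rfl
        · rw [Pi.smul_apply, hsupp x hx, smul_zero, mul_zero]
      · intro y _ hy
        by_cases hxy : ∀ t f, x t f ≤ y t f
        · have hlt := depth_weight_lt hxy hy.symm
          rw [hsupp y fun hh => (h.trans_lt hlt).ne (by rw [hh]), mul_zero]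
        · push Not at hxy
          obtain ⟨t, f, hlt⟩ := hxy
          rw [locPow_conjTranspose_apply_eq_zero hb hlt, zero_mul]
      · simp

end HighestWeight

section Averaging

variable {X : Type*} [Fintype X]

/-- The squared Frobenius norm. -/
def frob (M : Matrix X X ℂ) : ℝ := ∑ x, ∑ y, ‖M x y‖ ^ 2

lemma frob_eq_trace (M : Matrix X X ℂ) : (frob M : ℂ) = (M * M.conjTranspose).trace := by
  simp only [frob, Matrix.trace, Matrix.diag_apply, Matrix.mul_apply, Matrix.conjTranspose_apply]
  push_cast
  refine Finset.sum_congr rfl fun x _ => Finset.sum_congr rfl fun y _ => ?_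
  exact (Complex.mul_conj' (M x y)).symm

lemma frob_conj [DecidableEq X] {U : Matrix X X ℂ} (hU : U.conjTranspose * U = 1)
    (M : Matrix X X ℂ) : frob (U * M * U.conjTranspose) = frob M := by
  have h : (frob (U * M * U.conjTranspose) : ℂ) = frob M := by
    rw [frob_eq_trace, frob_eq_trace, Matrix.conjTranspose_mul, Matrix.conjTranspose_mul,
      Matrix.conjTranspose_conjTranspose]
    calc (U * M * U.conjTranspose * (U * (M.conjTranspose * U.conjTranspose))).trace
        = (U * (M * (U.conjTranspose * U) * M.conjTranspose * U.conjTranspose)).trace := by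
          simp only [Matrix.mul_assoc]
      _ = (M * M.conjTranspose).trace := by
          rw [Matrix.trace_mul_comm, hU, Matrix.mul_one, Matrix.mul_assoc, hU, Matrix.mul_one]
  exact_mod_cast h

lemma exists_conj_invariant [DecidableEq X] {S : Set (Matrix X X ℂ)} (hS : IsClosed S)
    (hne : S.Nonempty) (hmid : ∀ M ∈ S, ∀ M' ∈ S, (1 / 2 : ℂ) • (M + M') ∈ S)
    {G : Set (Matrix X X ℂ)} (hG : ∀ U ∈ G, U.conjTranspose * U = 1)
    (hGS : ∀ U ∈ G, ∀ M ∈ S, U * M * U.conjTranspose ∈ S) :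
    ∃ R ∈ S, ∀ U ∈ G, U * R * U.conjTranspose = R := by
  obtain ⟨M₀, hM₀⟩ := hne
  have hcont : Continuous (frob : Matrix X X ℂ → ℝ) := by
    unfold frob
    exact continuous_finsetSum _ fun x _ => continuous_finsetSum _ fun y _ =>
      ((continuous_id.matrix_elem x y).norm.pow 2)
  have hcomp : IsCompact (S ∩ {M | frob M ≤ frob M₀}) := by
    refine (isCompact_univ_pi fun _ : X => isCompact_univ_pi fun _ : X =>
      isCompact_closedBall (0 : ℂ) (Real.sqrt (frob M₀))).of_isClosed_subset
      (hS.inter (isClosed_le hcont continuous_const)) ?_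
    rintro M ⟨-, hM⟩ x - y -
    rw [mem_closedBall_zero_iff]
    refine Real.le_sqrt_of_sq_le (le_trans ?_ hM)
    refine le_trans (Finset.single_le_sum (f := fun y => ‖M x y‖ ^ 2) (fun _ _ => sq_nonneg _)
      (Finset.mem_univ y)) ?_
    exact Finset.single_le_sum (f := fun x => ∑ y, ‖M x y‖ ^ 2)
      (fun _ _ => Finset.sum_nonneg fun _ _ => sq_nonneg _) (Finset.mem_univ x)
  obtain ⟨R, ⟨hRS, hR₀⟩, hmin⟩ :=
    hcomp.exists_isMinOn ⟨M₀, hM₀, le_refl (frob M₀)⟩ hcont.continuousOn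
  have hmin' : ∀ M ∈ S, frob R ≤ frob M := by
    intro M hM
    rcases le_or_gt (frob M) (frob M₀) with h | h
    · exact hmin ⟨hM, h⟩
    · exact le_trans hR₀ h.le
  refine ⟨R, hRS, fun U hU => ?_⟩
  set R' := U * R * U.conjTranspose with hR'
  have h1 : frob R' = frob R := frob_conj (hG U hU) R
  have h2 := hmin' _ (hmid R hRS R' (hGS U hU R hRS))
  have hpar : frob ((1 / 2 : ℂ) • (R + R')) + frob ((1 / 2 : ℂ) • (R - R')) =
      (frob R + frob R') / 2 := by
    simp only [frob, ← Finset.sum_add_distrib, Finset.sum_div]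
    refine Finset.sum_congr rfl fun x _ => Finset.sum_congr rfl fun y _ => ?_
    simp only [Matrix.smul_apply, Matrix.add_apply, Matrix.sub_apply, norm_smul, mul_pow]
    have := parallelogram_law_with_norm ℝ (R x y) (R' x y)
    norm_num
    linarith
  have h0 : frob ((1 / 2 : ℂ) • (R - R')) ≤ 0 := by linarith
  have h3 : ∀ x y, ‖((1 / 2 : ℂ) • (R - R')) x y‖ ^ 2 = 0 := by
    intro x y
    refine le_antisymm (le_trans ?_ h0) (sq_nonneg _)
    refine le_trans (Finset.single_le_sum (f := fun y => ‖((1 / 2 : ℂ) • (R - R')) x y‖ ^ 2)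
      (fun _ _ => sq_nonneg _) (Finset.mem_univ y)) ?_
    exact Finset.single_le_sum (f := fun x => ∑ y, ‖((1 / 2 : ℂ) • (R - R')) x y‖ ^ 2)
      (fun _ _ => Finset.sum_nonneg fun _ _ => sq_nonneg _) (Finset.mem_univ x)
  ext x y
  have := h3 x y
  simp [sub_eq_zero] at this
  exact this.symm

lemma exists_top_eigenvalue [DecidableEq X] [Nonempty X] {R : Matrix X X ℂ} (hR : R.IsHermitian) :
    ∃ r : ℝ, (∃ w ≠ 0, R.mulVec w = (r : ℂ) • w) ∧
      ∀ w, (star w ⬝ᵥ R.mulVec w).re ≤ r * nsq w := by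
  obtain ⟨i, hi⟩ := Finite.exists_max hR.eigenvalues
  refine ⟨hR.eigenvalues i, ⟨(hR.eigenvectorBasis i : X → ℂ), ?_, ?_⟩, fun w => ?_⟩
  · intro h
    have h1 := hR.eigenvectorBasis.orthonormal.ne_zero i
    exact h1 (by ext x; exact congrFun h x)
  · have := hR.mulVec_eigenvectorBasis i
    rw [this]
    ext x
    simp
  · set U : Matrix X X ℂ := (hR.eigenvectorUnitary : Matrix X X ℂ) with hU
    have hU2 : U * U.conjTranspose = 1 := by
      have := Unitary.mul_star_self_of_mem hR.eigenvectorUnitary.2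
      simpa [Matrix.star_eq_conjTranspose] using this
    have hspec : R = U * Matrix.diagonal (fun i => (hR.eigenvalues i : ℂ)) * U.conjTranspose := by
      have := hR.spectral_theorem
      rw [Unitary.conjStarAlgAut_apply] at this
      simpa [Matrix.star_eq_conjTranspose, Function.comp_def] using this
    have h1 : nsq (U.conjTranspose.mulVec w) = nsq w :=
      nsq_mulVec_of_unitary (by rwa [Matrix.conjTranspose_conjTranspose]) w
    have h2 : star w ⬝ᵥ R.mulVec w =
        ∑ x, (hR.eigenvalues x * ‖U.conjTranspose.mulVec w x‖ ^ 2 : ℂ) := by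
      conv_lhs => rw [hspec]
      rw [← Matrix.mulVec_mulVec, ← Matrix.mulVec_mulVec, Matrix.dotProduct_mulVec,
        show Matrix.vecMul (star w) U = star (U.conjTranspose.mulVec w) by
          rw [Matrix.star_mulVec, Matrix.conjTranspose_conjTranspose]]
      simp only [dotProduct, Matrix.mulVec_diagonal, Pi.star_apply]
      refine Finset.sum_congr rfl fun x _ => ?_
      rw [← Complex.mul_conj']
      simp only [Complex.star_def]
      ring
    have h3 : star w ⬝ᵥ R.mulVec w =
        ((∑ x, hR.eigenvalues x * ‖U.conjTranspose.mulVec w x‖ ^ 2 : ℝ) : ℂ) := by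
      rw [h2]; push_cast; rfl
    rw [h3, Complex.ofReal_re, ← h1, nsq, Finset.mul_sum]
    exact Finset.sum_le_sum fun x _ => mul_le_mul_of_nonneg_right (hi x) (sq_nonneg _)

end Averaging

section Orbit

variable {F : Type*} [Fintype F] [DecidableEq F] {d : F → ℕ} {N : ℕ}

/-- A family of unitary matrices. -/
def IsUnitaryFamily (k : ∀ f, Matrix (Fin (d f)) (Fin (d f)) ℂ) : Prop :=
  ∀ f, (k f).conjTranspose * k f = 1

omit [Fintype F] [DecidableEq F] in
lemma isUnitaryFamily_one : IsUnitaryFamily (d := d) fun _ => 1 := fun _ => by simp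

omit [Fintype F] [DecidableEq F] in
lemma IsUnitaryFamily.mul {k k' : ∀ f, Matrix (Fin (d f)) (Fin (d f)) ℂ} (hk : IsUnitaryFamily k)
    (hk' : IsUnitaryFamily k') : IsUnitaryFamily fun f => k f * k' f := fun f => by
  rw [Matrix.conjTranspose_mul, Matrix.mul_assoc, ← Matrix.mul_assoc (k f).conjTranspose, hk f,
    Matrix.one_mul, hk' f]

lemma IsUnitaryFamily.locPow {k : ∀ f, Matrix (Fin (d f)) (Fin (d f)) ℂ} (hk : IsUnitaryFamily k) :
    (locPow N k).conjTranspose * locPow N k = 1 := by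
  rw [← locPow_conjTranspose, ← locPow_mul, funext hk, locPow_one]

lemma IsUnitaryFamily.loc {k : ∀ f, Matrix (Fin (d f)) (Fin (d f)) ℂ} (hk : IsUnitaryFamily k) :
    (loc k).conjTranspose * loc k = 1 := by
  rw [← kron_conjTranspose, ← kron_mul, funext hk, kron_one]

/-- Hermitian matrices of trace one whose quadratic form is bounded by the overlaps with the
unitary orbit of `u`. -/
def orbitHull (u : (Fin N → ∀ f, Fin (d f)) → ℂ) :
    Set (Matrix (Fin N → ∀ f, Fin (d f)) (Fin N → ∀ f, Fin (d f)) ℂ) :=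
  {M | M.conjTranspose = M ∧ M.trace = 1 ∧ ∀ (w : (Fin N → ∀ f, Fin (d f)) → ℂ) (C : ℝ),
    (∀ k, IsUnitaryFamily k → ‖star w ⬝ᵥ (locPow N k).mulVec u‖ ^ 2 ≤ C) →
      (star w ⬝ᵥ M.mulVec w).re ≤ C}

lemma isClosed_orbitHull (u : (Fin N → ∀ f, Fin (d f)) → ℂ) : IsClosed (orbitHull u) := by
  simp only [orbitHull, Set.ofPred_and, Set.ofPred_forall]
  refine (isClosed_eq continuous_id.matrix_conjTranspose continuous_id).inter
    ((isClosed_eq continuous_id.matrix_trace continuous_const).inter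
      (isClosed_iInter fun w => isClosed_iInter fun C => isClosed_iInter fun _ =>
        isClosed_le (Complex.continuous_re.comp ?_) continuous_const))
  exact continuous_const.dotProduct (continuous_id.matrix_mulVec continuous_const)

lemma vecMulVec_mem_orbitHull {u : (Fin N → ∀ f, Fin (d f)) → ℂ} (hu : nsq u = 1) :
    Matrix.vecMulVec u (star u) ∈ orbitHull u := by
  refine ⟨?_, ?_, fun w C h => ?_⟩
  · rw [Matrix.conjTranspose_vecMulVec, star_star]
  · rw [Matrix.trace_vecMulVec, dotProduct_comm, dotProduct_star_self, hu, Complex.ofReal_one]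
  · have h1 := h _ isUnitaryFamily_one
    rw [locPow_one, Matrix.one_mulVec] at h1
    refine le_trans (le_of_eq ?_) h1
    rw [Matrix.vecMulVec_mulVec, dotProduct_smul]
    have h2 : star u ⬝ᵥ w = star (star w ⬝ᵥ u) := by
      rw [← Matrix.star_dotProduct_star, star_star, dotProduct_comm]
    rw [h2, op_smul_eq_smul, smul_eq_mul, mul_comm, Complex.star_def, Complex.mul_conj']
    norm_cast

lemma midpoint_mem_orbitHull {u : (Fin N → ∀ f, Fin (d f)) → ℂ}
    {M M' : Matrix (Fin N → ∀ f, Fin (d f)) (Fin N → ∀ f, Fin (d f)) ℂ}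
    (hM : M ∈ orbitHull u) (hM' : M' ∈ orbitHull u) : (1 / 2 : ℂ) • (M + M') ∈ orbitHull u := by
  refine ⟨?_, ?_, fun w C h => ?_⟩
  · rw [Matrix.conjTranspose_smul, Matrix.conjTranspose_add, hM.1, hM'.1]
    congr 1
    simp
  · rw [Matrix.trace_smul, Matrix.trace_add, hM.2.1, hM'.2.1]
    norm_num
  · have h1 := hM.2.2 w C h
    have h2 := hM'.2.2 w C h
    rw [Matrix.smul_mulVec, Matrix.add_mulVec, dotProduct_smul, dotProduct_add, smul_eq_mul,
      show (1 / 2 : ℂ) = ((1 / 2 : ℝ) : ℂ) by norm_num, Complex.re_ofReal_mul, Complex.add_re]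
    linarith

lemma conj_mem_orbitHull {u : (Fin N → ∀ f, Fin (d f)) → ℂ}
    {M : Matrix (Fin N → ∀ f, Fin (d f)) (Fin N → ∀ f, Fin (d f)) ℂ} (hM : M ∈ orbitHull u)
    {k : ∀ f, Matrix (Fin (d f)) (Fin (d f)) ℂ} (hk : IsUnitaryFamily k) :
    locPow N k * M * (locPow N k).conjTranspose ∈ orbitHull u := by
  have hstar : ∀ w, star ((locPow N k).conjTranspose.mulVec w) =
      Matrix.vecMul (star w) (locPow N k) := fun w => by
    rw [Matrix.star_mulVec, Matrix.conjTranspose_conjTranspose]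
  refine ⟨?_, ?_, fun w C h => ?_⟩
  · rw [Matrix.conjTranspose_mul, Matrix.conjTranspose_mul, Matrix.conjTranspose_conjTranspose,
      hM.1, Matrix.mul_assoc]
  · rw [Matrix.trace_mul_comm, ← Matrix.mul_assoc, hk.locPow, Matrix.one_mul, hM.2.1]
  · have h1 := hM.2.2 ((locPow N k).conjTranspose.mulVec w) C fun k' hk' => by
      rw [hstar, ← Matrix.dotProduct_mulVec, Matrix.mulVec_mulVec, ← locPow_mul]
      exact h _ (hk.mul hk')
    rwa [hstar, ← Matrix.dotProduct_mulVec, Matrix.mulVec_mulVec, Matrix.mulVec_mulVec] at h1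

/-- The type of an element of a product: how often each letter occurs. -/
def letterCount {ι : Type*} [DecidableEq ι] (x : Fin N → ι) (i : ι) : Fin (N + 1) :=
  ⟨(Finset.univ.filter fun t => x t = i).card,
    Nat.lt_succ_of_le ((Finset.card_le_univ _).trans (by simp))⟩

lemma tpow_eq_of_letterCount_eq {ι : Type*} [Fintype ι] [DecidableEq ι] (φ : ι → ℂ)
    {x y : Fin N → ι}
    (h : letterCount x = letterCount y) : tpow N φ x = tpow N φ y := by
  have key : ∀ z : Fin N → ι, tpow N φ z = ∏ i, φ i ^ (letterCount z i : ℕ) := by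
    intro z
    rw [tpow, ← Finset.prod_fiberwise' Finset.univ z φ]
    exact Finset.prod_congr rfl fun i _ => Finset.prod_const _
  rw [key, key, h]

lemma sum_fiber_trace_le {ψ : (∀ f, Fin (d f)) → ℂ}
    {R : Matrix (Fin N → ∀ f, Fin (d f)) (Fin N → ∀ f, Fin (d f)) ℂ}
    (hR : R ∈ orbitHull (tpow N ψ)) {r : ℝ} (hr : ∀ w, (star w ⬝ᵥ R.mulVec w).re ≤ r * nsq w)
    (S : Finset (Fin N → ∀ f, Fin (d f))) (hS : S.Nonempty)
    (hSc : ∀ x ∈ S, ∀ y ∈ S, letterCount x = letterCount y) : ∑ x ∈ S, (R x x).re ≤ r := by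
  have hpair : ∀ x ∈ S, ∀ y ∈ S,
      (R x x).re - (R x y).re - (R y x).re + (R y y).re ≤ 0 := by
    intro x hx y hy
    have h := hR.2.2 (Pi.single x 1 - Pi.single y 1) 0 fun k hk => by
      rw [kron_mulVec_tpow, star_sub, sub_dotProduct, ← Pi.single_star, ← Pi.single_star, star_one,
        single_one_dotProduct, single_one_dotProduct, tpow_eq_of_letterCount_eq _ (hSc x hx y hy)]
      simp
    rw [star_sub, ← Pi.single_star, ← Pi.single_star, star_one, sub_dotProduct, Matrix.mulVec_sub,
      dotProduct_sub, dotProduct_sub, single_one_dotProduct, single_one_dotProduct,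
      single_one_dotProduct, single_one_dotProduct] at h
    simp only [Matrix.mulVec_single_one, Matrix.col_apply, Complex.sub_re] at h
    linarith
  let w : (Fin N → ∀ f, Fin (d f)) → ℂ := fun x => if x ∈ S then 1 else 0
  have h1 : (star w ⬝ᵥ R.mulVec w).re = ∑ x ∈ S, ∑ y ∈ S, (R x y).re := by
    simp only [dotProduct, Matrix.mulVec, w, Pi.star_apply, apply_ite star, star_one, star_zero,
      ite_mul, one_mul, zero_mul, mul_ite, mul_one, mul_zero, Finset.sum_ite_mem,
      Finset.univ_inter, Complex.re_sum]
  have h2 : nsq w = S.card := by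
    simp [nsq, w, apply_ite norm]
  have h3 : ∑ x ∈ S, ∑ y ∈ S, ((R x x).re - (R x y).re - (R y x).re + (R y y).re) ≤ 0 :=
    Finset.sum_nonpos fun x hx => Finset.sum_nonpos fun y hy => hpair x hx y hy
  have h4 : ∑ x ∈ S, ∑ y ∈ S, (R y x).re = ∑ x ∈ S, ∑ y ∈ S, (R x y).re := Finset.sum_comm
  simp only [Finset.sum_add_distrib, Finset.sum_sub_distrib, Finset.sum_const, h4,
    nsmul_eq_mul, ← Finset.mul_sum] at h3
  have h5 := hr w
  rw [h1, h2] at h5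
  have hpos : (0 : ℝ) < S.card := by exact_mod_cast hS.card_pos
  nlinarith

lemma exists_highestWeight_overlap {ψ : (∀ f, Fin (d f)) → ℂ} (hψ : nsq ψ = 1) (N : ℕ) :
    ∃ v : (Fin N → ∀ f, Fin (d f)) → ℂ, nsq v = 1 ∧ ∃ m : ∀ f, Fin (d f) → ℕ,
      (∀ f, Antitone (m f)) ∧ (∀ f, ∑ i, m f i = N) ∧
      (∀ b, IsLowerFamily b → (locPow N fun f => (b f).conjTranspose).mulVec v =
        (∏ f, ∏ i, star (b f i i) ^ m f i) • v) ∧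
      ∃ k, IsUnitaryFamily k ∧ 1 / (2 * ((N + 1 : ℕ) : ℝ) ^ Fintype.card (∀ f, Fin (d f))) ≤
        ‖star v ⬝ᵥ tpow N ((loc k).mulVec ψ)‖ ^ 2 := by
  classical
  have hu : nsq (tpow N ψ) = 1 := by rw [nsq_tpow, hψ, one_pow]
  obtain ⟨R, hR, hinv⟩ := exists_conj_invariant (isClosed_orbitHull (tpow N ψ))
    ⟨_, vecMulVec_mem_orbitHull hu⟩ (fun M hM M' hM' => midpoint_mem_orbitHull hM hM')
    (G := {U | ∃ k, IsUnitaryFamily k ∧ U = locPow N k}) (by rintro _ ⟨k, hk, rfl⟩; exact hk.locPow)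
    (by rintro _ ⟨k, hk, rfl⟩ M hM; exact conj_mem_orbitHull hM hk)
  have : Nonempty (Fin N → ∀ f, Fin (d f)) := by
    by_contra h
    rw [not_nonempty_iff] at h
    simp [nsq] at hu
  obtain ⟨r, ⟨w, hw0, hw⟩, hr⟩ := exists_top_eigenvalue (show R.IsHermitian from hR.1)
  set D : ℝ := ((N + 1 : ℕ) : ℝ) ^ Fintype.card (∀ f, Fin (d f)) with hD
  have hDpos : 0 < D := by positivity
  have htr : ∑ x, (R x x).re = 1 := by
    have := congrArg Complex.re hR.2.1
    simpa [Matrix.trace] using this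
  have hrD : 1 ≤ r * D := by
    let T := Finset.univ.image (letterCount (N := N) (ι := ∀ f, Fin (d f)))
    have h1 : 1 ≤ T.card * r := by
      rw [← htr, ← Finset.sum_fiberwise_of_maps_to (t := T) (g := letterCount)
        (fun x _ => Finset.mem_image_of_mem _ (Finset.mem_univ x)), ← nsmul_eq_mul]
      refine Finset.sum_le_card_nsmul _ _ _ fun κ hκ => ?_
      obtain ⟨x, -, hx⟩ := Finset.mem_image.mp hκ
      refine sum_fiber_trace_le hR hr _ ⟨x, by simpa using hx⟩ fun y hy z hz => ?_
      rw [(Finset.mem_filter.mp hy).2, (Finset.mem_filter.mp hz).2]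
    have h2 : (T.card : ℝ) ≤ D := by
      rw [hD]
      have := Finset.card_le_univ T
      rw [Fintype.card_fun, Fintype.card_fin] at this
      exact_mod_cast this
    have h3 : 0 ≤ r := by
      by_contra! h
      nlinarith [(Nat.cast_nonneg T.card : (0 : ℝ) ≤ T.card)]
    nlinarith
  let E := Module.End.eigenspace (Matrix.toLin' R) (r : ℂ)
  have hE : ∀ x, x ∈ E ↔ R.mulVec x = (r : ℂ) • x := fun x => by
    rw [Module.End.mem_eigenspace_iff, Matrix.toLin'_apply]
  have hstab : IsUnitaryStable E := by
    intro k hk x hx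
    rw [hE] at hx ⊢
    have h1 : R * locPow N k = locPow N k * R := by
      conv_lhs => rw [← hinv _ ⟨k, hk, rfl⟩]
      rw [Matrix.mul_assoc, IsUnitaryFamily.locPow hk, Matrix.mul_one]
    rw [Matrix.mulVec_mulVec, h1, ← Matrix.mulVec_mulVec, hx, Matrix.mulVec_smul]
  obtain ⟨v, hv, hv0, m, hm, hmN, hvb⟩ := exists_highestWeight hstab
    ((Submodule.ne_bot_iff _).mpr ⟨w, (hE w).mpr hw, hw0⟩)
  rw [hE] at hv
  have hvpos : 0 < nsq v := lt_of_le_of_ne (nsq_nonneg v) fun h => hv0 (nsq_eq_zero.mp h.symm)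
  let s : ℂ := ((Real.sqrt (nsq v))⁻¹ : ℝ)
  have hsv : nsq (s • v) = 1 := by
    rw [nsq_smul, Complex.norm_real, Real.norm_of_nonneg (by positivity), inv_pow,
      Real.sq_sqrt hvpos.le, inv_mul_cancel₀ hvpos.ne']
  refine ⟨s • v, hsv, m, hm, hmN, fun b hb => ?_, ?_⟩
  · rw [Matrix.mulVec_smul, hvb b hb, smul_comm]
  · by_contra! hlt
    have h1 := hR.2.2 (s • v) _ fun k hk => by
      rw [kron_mulVec_tpow]
      exact (hlt k hk).le
    rw [Matrix.mulVec_smul, hv, smul_comm, dotProduct_smul, dotProduct_star_self, hsv,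
      Complex.ofReal_one, smul_eq_mul, mul_one, Complex.ofReal_re,
      le_div_iff₀ (by positivity)] at h1
    linarith

end Orbit

section SpectralPoints

open Filter Topology

lemma eq_of_antitone_of_map_eq {n : ℕ} {lam mu : Fin n → ℝ} (hlam : Antitone lam)
    (hmu : Antitone mu) (h : Finset.univ.val.map lam = Finset.univ.val.map mu) : lam = mu := by
  rw [Fin.univ_val_map, Fin.univ_val_map, Multiset.coe_eq_coe] at h
  exact List.ofFn_injective (h.eq_of_sortedGE (List.sortedGE_ofFn_iff.mpr hlam)
    (List.sortedGE_ofFn_iff.mpr hmu))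

lemma eq_of_antitone_of_det_eq {n : ℕ} {lam mu : Fin n → ℝ} (hlam : Antitone lam)
    (hmu : Antitone mu)
    (h : ∀ z : ℂ, (Matrix.scalar (Fin n) z - Matrix.diagonal fun i => (lam i : ℂ)).det =
      (Matrix.scalar (Fin n) z - Matrix.diagonal fun i => (mu i : ℂ)).det) : lam = mu := by
  refine eq_of_antitone_of_map_eq hlam hmu ?_
  have key : ∀ (nu : Fin n → ℝ) (z : ℂ),
      (Matrix.scalar (Fin n) z - Matrix.diagonal fun i => (nu i : ℂ)).det = ∏ i, (z - nu i) := by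
    intro nu z
    rw [Matrix.scalar_apply, Matrix.diagonal_sub, Matrix.det_diagonal]
  have hpoly : ((Finset.univ.val.map lam).map fun r : ℝ => Polynomial.X - Polynomial.C r).prod =
      ((Finset.univ.val.map mu).map fun r : ℝ => Polynomial.X - Polynomial.C r).prod := by
    refine Polynomial.funext fun r => ?_
    have h1 := h r
    rw [key, key] at h1
    simp only [Multiset.map_map, Function.comp_def]
    have h2 : ∀ nu : Fin n → ℝ, (Multiset.map (fun i => Polynomial.X - Polynomial.C (nu i))
        Finset.univ.val).prod = ∏ i, (Polynomial.X - Polynomial.C (nu i)) := fun _ => rfl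
    rw [h2, h2, Polynomial.eval_prod, Polynomial.eval_prod]
    simp only [Polynomial.eval_sub, Polynomial.eval_X, Polynomial.eval_C]
    exact_mod_cast h1
  have h3 := congrArg Polynomial.roots hpoly
  rwa [Polynomial.roots_multiset_prod_X_sub_C, Polynomial.roots_multiset_prod_X_sub_C] at h3

lemma det_scalar_sub_conj {n : ℕ} {k : Matrix (Fin n) (Fin n) ℂ} (hk : k.conjTranspose * k = 1)
    (A : Matrix (Fin n) (Fin n) ℂ) (z : ℂ) :
    (Matrix.scalar (Fin n) z - k * A * k.conjTranspose).det =
      (Matrix.scalar (Fin n) z - A).det := by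
  have hkk : k * k.conjTranspose = 1 := mul_eq_one_comm.mp hk
  have h : Matrix.scalar (Fin n) z - k * A * k.conjTranspose =
      k * (Matrix.scalar (Fin n) z - A) * k.conjTranspose := by
    rw [Matrix.mul_sub, Matrix.sub_mul, ← (Matrix.scalar_commute z (fun _ => mul_comm _ _) k).eq,
      Matrix.mul_assoc (Matrix.scalar _ z), hkk, Matrix.mul_one]
  rw [h, Matrix.det_mul_comm, ← Matrix.mul_assoc, hk, Matrix.one_mul]

variable {F : Type*} [Fintype F] [DecidableEq F] {d : F → ℕ}

/-- The families of nonincreasing spectra of the marginals of unit vectors. -/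
def marginalSpectra (d : F → ℕ) : Set (∀ f, Fin (d f) → ℝ) :=
  {lam | (∀ f, Antitone (lam f)) ∧ ∃ ψ : (∀ f, Fin (d f)) → ℂ, nsq ψ = 1 ∧
    ∀ f, marg f ψ = Matrix.diagonal fun i => (lam f i : ℂ)}

lemma isClosed_marginalSpectra : IsClosed (marginalSpectra d) := by
  refine IsSeqClosed.isClosed fun lam l hlam hl => ?_
  choose hanti ψ hψ hmarg using hlam
  obtain ⟨φ, hφ, θ, hθ, hlim⟩ := isCompact_nsq_eq_one.tendsto_subseq hψ
  have hl' : ∀ f i, Tendsto (fun n => lam (θ n) f i) atTop (𝓝 (l f i)) := fun f i =>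
    (tendsto_pi_nhds.mp (tendsto_pi_nhds.mp hl f) i).comp hθ.tendsto_atTop
  refine ⟨fun f i j hij => le_of_tendsto_of_tendsto' (hl' f j) (hl' f i)
    fun n => hanti (θ n) f hij, φ, hφ, fun f => ?_⟩
  refine tendsto_nhds_unique (((continuous_marg f).tendsto φ).comp hlim) ?_
  refine Tendsto.congr (fun n => (hmarg (θ n) f).symm) ?_
  have hc : Continuous fun v : Fin (d f) → ℝ => Matrix.diagonal fun i => (v i : ℂ) :=
    Continuous.matrix_diagonal (by fun_prop)
  exact (hc.tendsto (l f)).comp (tendsto_pi_nhds.mpr fun i => hl' f i)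

/-- A highest weight covariant of degree `N` and weight `m` for the local group. -/
def IsCovariant {N : ℕ} (v : (Fin N → ∀ f, Fin (d f)) → ℂ) (m : ∀ f, Fin (d f) → ℕ) : Prop :=
  nsq v = 1 ∧ (∀ f, Antitone (m f)) ∧ (∀ f, ∑ i, m f i = N) ∧
    ∀ b, IsLowerFamily b → (locPow N fun f => (b f).conjTranspose).mulVec v =
      (∏ f, ∏ i, star (b f i i) ^ m f i) • v

lemma IsCovariant.rpow_mul_chi_le {N : ℕ} (hN : N ≠ 0) {v : (Fin N → ∀ f, Fin (d f)) → ℂ}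
    {m : ∀ f, Fin (d f) → ℕ} (hv : IsCovariant v m) (φ : (∀ f, Fin (d f)) → ℂ)
    {b : ∀ f, Matrix (Fin (d f)) (Fin (d f)) ℂ} (hb : IsLowerFamily b) {C : ℝ} (hC0 : 0 ≤ C)
    (hC : C ≤ ‖star v ⬝ᵥ tpow N φ‖ ^ 2) :
    C ^ (N : ℝ)⁻¹ * chi (fun f i => (m f i : ℝ) / N) b ≤ nsq ((loc b).mulVec φ) := by
  have h1 : star v ⬝ᵥ tpow N ((loc b).mulVec φ) =
      (∏ f, ∏ i, (b f i i) ^ m f i) * (star v ⬝ᵥ tpow N φ) := by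
    have h2 := congrArg star (hv.2.2.2 b hb)
    rw [locPow_conjTranspose, Matrix.star_mulVec, Matrix.conjTranspose_conjTranspose] at h2
    rw [← kron_mulVec_tpow, Matrix.dotProduct_mulVec, h2, star_smul, smul_dotProduct, smul_eq_mul]
    simp
  have h2 := norm_dotProduct_sq_le v (tpow N ((loc b).mulVec φ))
  rw [hv.1, one_mul, nsq_tpow, h1, norm_mul, mul_pow] at h2
  have h3 : chi (fun f i => (m f i : ℝ) / N) b ^ N = ‖∏ f, ∏ i, (b f i i) ^ m f i‖ ^ 2 := by
    simp only [chi, norm_prod, norm_pow, ← Finset.prod_pow]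
    refine Finset.prod_congr rfl fun f _ => Finset.prod_congr rfl fun i _ => ?_
    rw [← Real.rpow_natCast, ← Real.rpow_mul (sq_nonneg _),
      div_mul_cancel₀ _ (by exact_mod_cast hN), Real.rpow_natCast, ← pow_mul, ← pow_mul, mul_comm]
  refine (pow_le_pow_iff_left₀ (mul_nonneg (Real.rpow_nonneg hC0 _) (chi_pos _ hb).le)
    (nsq_nonneg _) hN).mp ?_
  rw [mul_pow, h3, ← Real.rpow_natCast, ← Real.rpow_mul hC0,
    inv_mul_cancel₀ (by exact_mod_cast hN), Real.rpow_one]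
  refine le_trans ?_ h2
  rw [mul_comm]
  exact mul_le_mul_of_nonneg_left hC (sq_nonneg _)

/-- The normalized weights of covariants that do not vanish identically. -/
def covariantWeights (d : F → ℕ) : Set (∀ f, Fin (d f) → ℝ) :=
  {q | ∃ N : ℕ, N ≠ 0 ∧ ∃ (v : (Fin N → ∀ f, Fin (d f)) → ℂ) (m : ∀ f, Fin (d f) → ℕ),
    IsCovariant v m ∧ (∃ φ, star v ⬝ᵥ tpow N φ ≠ 0) ∧ q = fun f i => (m f i : ℝ) / N}

lemma tendsto_overlap_bound (D : ℕ) : Tendsto (fun n : ℕ =>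
    (1 / (2 * ((n + 1 + 1 : ℕ) : ℝ) ^ D)) ^ (((n + 1 : ℕ) : ℝ)⁻¹)) atTop (𝓝 1) := by
  have hn : Tendsto (fun n : ℕ => ((n + 1 : ℕ) : ℝ)⁻¹) atTop (𝓝 0) :=
    tendsto_inv_atTop_zero.comp (tendsto_natCast_atTop_atTop.comp (tendsto_add_atTop_nat 1))
  have h1 : Tendsto (fun n : ℕ => (1 / 2 : ℝ) ^ (((n + 1 : ℕ) : ℝ)⁻¹)) atTop (𝓝 1) := by
    simpa using tendsto_const_nhds.rpow hn (Or.inl (by norm_num : (1 / 2 : ℝ) ≠ 0))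
  have h2 := (tendsto_rpow_div_mul_add (-D : ℝ) 1 (-1) (by norm_num)).comp
    (tendsto_natCast_atTop_atTop.comp (tendsto_add_atTop_nat 2))
  have h3 := h1.mul h2
  rw [one_mul] at h3
  refine h3.congr fun n => ?_
  simp only [Function.comp_apply]
  have hp : (0 : ℝ) ≤ ((n + 2 : ℕ) : ℝ) := Nat.cast_nonneg _
  have he : (-D : ℝ) / (1 * ((n + 2 : ℕ) : ℝ) + -1) = -D * ((n + 1 : ℕ) : ℝ)⁻¹ := by
    push_cast
    rw [div_eq_mul_inv]
    congr 2
    ring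
  rw [he, Real.rpow_mul hp, Real.rpow_neg hp, Real.rpow_natCast,
    ← Real.mul_rpow (by norm_num) (by positivity)]
  congr 1
  rw [one_div, one_div, mul_inv]

lemma marginalSpectra_subset_closure : marginalSpectra d ⊆ closure (covariantWeights d) := by
  rintro lam ⟨hanti, ψ, hψ, hmarg⟩
  choose v hv1 m hm hmN hvb k hk hover using fun n : ℕ => exists_highestWeight_overlap hψ (n + 1)
  have hcov : ∀ n, IsCovariant (v n) (m n) := fun n => ⟨hv1 n, hm n, hmN n, hvb n⟩
  let φ : ℕ → (∀ f, Fin (d f)) → ℂ := fun n => (loc (k n)).mulVec ψ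
  let q : ℕ → ∀ f, Fin (d f) → ℝ := fun n f i => (m n f i : ℝ) / (n + 1 : ℕ)
  let C : ℕ → ℝ := fun n => 1 / (2 * ((n + 1 + 1 : ℕ) : ℝ) ^ Fintype.card (∀ f, Fin (d f)))
  have hCpos : ∀ n, 0 < C n := fun n => by positivity
  have hqC : ∀ n, q n ∈ covariantWeights d := fun n => by
    refine ⟨n + 1, n.succ_ne_zero, v n, m n, hcov n, ⟨φ n, fun h0 => ?_⟩, rfl⟩
    have := (hCpos n).trans_le (hover n)
    rw [show star (v n) ⬝ᵥ tpow (n + 1) ((loc (k n)).mulVec ψ) = 0 from h0] at this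
    simp at this
  obtain ⟨φ', lam', θ, hθ, hφlim, hqlim, hφ', hdom⟩ := exists_limit_dominating φ
    (fun n => by rw [nsq_mulVec_of_unitary (IsUnitaryFamily.loc (hk n)), hψ]) q 1
    (fun n f i => by
      have h1 : m n f i ≤ n + 1 := by
        rw [← hmN n f]
        exact Finset.single_le_sum (f := m n f) (fun _ _ => Nat.zero_le _) (Finset.mem_univ i)
      rw [abs_of_nonneg (by positivity)]
      exact div_le_one_of_le₀ (by exact_mod_cast h1) (by positivity))
    _ (tendsto_overlap_bound (Fintype.card (∀ f, Fin (d f))))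
    (fun n b hb => (hcov n).rpow_mul_chi_le n.succ_ne_zero (φ n) hb (hCpos n).le (hover n))
  have hq : ∀ f i, Tendsto (fun n => q (θ n) f i) atTop (𝓝 (lam' f i)) := fun f i =>
    tendsto_pi_nhds.mp (tendsto_pi_nhds.mp hqlim f) i
  have hlam : lam' = lam := by
    funext f
    refine eq_of_antitone_of_det_eq (fun i j hij => le_of_tendsto_of_tendsto' (hq f j) (hq f i)
      fun n => ?_) (hanti f) fun z => ?_
    · exact div_le_div_of_nonneg_right (by exact_mod_cast hm (θ n) f hij) (by positivity)
    · have hdet : ∀ n, (Matrix.scalar (Fin (d f)) z - marg f (φ n)).det =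
          (Matrix.scalar (Fin (d f)) z - Matrix.diagonal fun i => (lam f i : ℂ)).det := by
        intro n
        rw [marg_loc (hk n), hmarg f, det_scalar_sub_conj (hk n f)]
      have hc : Continuous fun ψ : (∀ f, Fin (d f)) → ℂ =>
          (Matrix.scalar (Fin (d f)) z - marg f ψ).det :=
        (continuous_const.sub (continuous_marg f)).matrix_det
      rw [← marg_eq_diagonal hφ' hdom f]
      refine tendsto_nhds_unique ((hc.tendsto φ').comp hφlim) ?_
      exact Tendsto.congr (fun n => (hdet (θ n)).symm) tendsto_const_nhds
  rw [← hlam]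
  exact mem_closure_of_tendsto hqlim (Eventually.of_forall fun n => hqC (θ n))

lemma exists_common_nonvanishing {ι : Type*} [Fintype ι] {N N' : ℕ} {v : (Fin N → ι) → ℂ}
    {v' : (Fin N' → ι) → ℂ} {φ φ' : ι → ℂ} (h : star v ⬝ᵥ tpow N φ ≠ 0)
    (h' : star v' ⬝ᵥ tpow N' φ' ≠ 0) :
    ∃ ψ : ι → ℂ, star v ⬝ᵥ tpow N ψ ≠ 0 ∧ star v' ⬝ᵥ tpow N' ψ ≠ 0 := by
  let line : ℂ → ι → ℂ := fun z i => φ i + z * (φ' i - φ i)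
  let p : ∀ {n : ℕ}, ((Fin n → ι) → ℂ) → Polynomial ℂ := fun {n} u =>
    ∑ x, Polynomial.C (star (u x)) *
    ∏ t, (Polynomial.C (φ (x t)) + Polynomial.X * Polynomial.C (φ' (x t) - φ (x t)))
  have hp : ∀ {n : ℕ} (u : (Fin n → ι) → ℂ) (z : ℂ),
      (p u).eval z = star u ⬝ᵥ tpow n (line z) := by
    intro n u z
    simp only [p, Polynomial.eval_finsetSum, Polynomial.eval_mul, Polynomial.eval_C,
      Polynomial.eval_prod, Polynomial.eval_add, Polynomial.eval_X, dotProduct, tpow, line,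
      Pi.star_apply]
  have h0 : p v ≠ 0 := by
    intro h0
    apply h
    have := hp v 0
    rw [h0, Polynomial.eval_zero] at this
    simpa [line] using this.symm
  have h1 : p v' ≠ 0 := by
    intro h1
    apply h'
    have := hp v' 1
    rw [h1, Polynomial.eval_zero] at this
    simpa [line] using this.symm
  obtain ⟨z, hz⟩ : ∃ z, (p v * p v').eval z ≠ 0 := by
    by_contra! hz
    exact mul_ne_zero h0 h1 (Polynomial.funext fun z => by rw [hz, Polynomial.eval_zero])
  rw [Polynomial.eval_mul, hp, hp] at hz
  exact ⟨line z, left_ne_zero_of_mul hz, right_ne_zero_of_mul hz⟩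

lemma convexComb_mem_marginalSpectra {q q' : ∀ f, Fin (d f) → ℝ} (hq : q ∈ covariantWeights d)
    (hq' : q' ∈ covariantWeights d) {s t : ℝ} (hs : 0 ≤ s) (ht : 0 ≤ t) (hst : s + t = 1) :
    s • q + t • q' ∈ marginalSpectra d := by
  obtain ⟨N, hN, v, m, hv, ⟨φ, hφ⟩, rfl⟩ := hq
  obtain ⟨N', hN', v', m', hv', ⟨φ', hφ'⟩, rfl⟩ := hq'
  refine ⟨fun f i j hij => ?_, ?_⟩
  · simp only [Pi.add_apply, Pi.smul_apply, smul_eq_mul]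
    have h1 : (m f j : ℝ) ≤ m f i := by exact_mod_cast hv.2.1 f hij
    have h2 : (m' f j : ℝ) ≤ m' f i := by exact_mod_cast hv'.2.1 f hij
    gcongr
  · obtain ⟨ψ, h, h'⟩ := exists_common_nonvanishing hφ hφ'
    have hc : 0 < (‖star v ⬝ᵥ tpow N ψ‖ ^ 2) ^ (N : ℝ)⁻¹ := by positivity
    have hc' : 0 < (‖star v' ⬝ᵥ tpow N' ψ‖ ^ 2) ^ (N' : ℝ)⁻¹ := by positivity
    refine exists_marg_eq_diagonal (ψ := ψ)
      (mul_pos (Real.rpow_pos_of_pos hc s) (Real.rpow_pos_of_pos hc' t)) fun b hb => ?_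
    have h1 := hv.rpow_mul_chi_le hN ψ hb (sq_nonneg _) le_rfl
    have h2 := hv'.rpow_mul_chi_le hN' ψ hb (sq_nonneg _) le_rfl
    have p1 := chi_pos (fun f i => (m f i : ℝ) / N) hb
    have p2 := chi_pos (fun f i => (m' f i : ℝ) / N') hb
    rw [chi_convexComb _ _ hb, mul_mul_mul_comm, ← Real.mul_rpow hc.le p1.le,
      ← Real.mul_rpow hc'.le p2.le, ← Real.rpow_one (nsq ((loc b).mulVec ψ)), ← hst,
      Real.rpow_add ((mul_pos hc p1).trans_le h1)]
    exact mul_le_mul (Real.rpow_le_rpow (mul_pos hc p1).le h1 hs)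
      (Real.rpow_le_rpow (mul_pos hc' p2).le h2 ht)
      (Real.rpow_nonneg (mul_pos hc' p2).le _) (Real.rpow_nonneg (nsq_nonneg _) _)

theorem convex_marginalSpectra : Convex ℝ (marginalSpectra d) := by
  intro lam hlam mu hmu s t hs ht hst
  rw [← isClosed_marginalSpectra.closure_eq]
  exact map_mem_closure₂ (f := fun q q' => s • q + t • q') (by fun_prop)
    (marginalSpectra_subset_closure hlam) (marginalSpectra_subset_closure hmu)
    fun q hq q' hq' => convexComb_mem_marginalSpectra hq hq' hs ht hst

end SpectralPoints

section SpecDown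

variable {n : ℕ}

lemma IsSpecDown.exists_unitary {ρ : Matrix (Fin n) (Fin n) ℂ} {lam : Fin n → ℝ}
    (h : IsSpecDown ρ lam) : ∃ k : Matrix (Fin n) (Fin n) ℂ, k.conjTranspose * k = 1 ∧
      k * ρ * k.conjTranspose = Matrix.diagonal fun i => (lam i : ℂ) := by
  obtain ⟨-, hρ, σ, rfl⟩ := h
  set U : Matrix (Fin n) (Fin n) ℂ := (hρ.eigenvectorUnitary : Matrix (Fin n) (Fin n) ℂ) with hU
  have hU1 : U.conjTranspose * U = 1 := by
    have := Unitary.star_mul_self_of_mem hρ.eigenvectorUnitary.2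
    simpa [Matrix.star_eq_conjTranspose] using this
  have hspec : ρ = U * Matrix.diagonal (fun i => (hρ.eigenvalues i : ℂ)) * U.conjTranspose := by
    have := hρ.spectral_theorem
    rw [Unitary.conjStarAlgAut_apply] at this
    simpa [Matrix.star_eq_conjTranspose, Function.comp_def] using this
  have hd : U.conjTranspose * ρ * U = Matrix.diagonal (fun i => (hρ.eigenvalues i : ℂ)) := by
    conv_lhs => rw [hspec]
    calc _ = (U.conjTranspose * U) * Matrix.diagonal (fun i => (hρ.eigenvalues i : ℂ)) *
          (U.conjTranspose * U) := by simp only [Matrix.mul_assoc]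
      _ = _ := by rw [hU1, Matrix.one_mul, Matrix.mul_one]
  refine ⟨U.conjTranspose.submatrix σ id, mul_eq_one_comm.mp ?_, ?_⟩
  · rw [Matrix.conjTranspose_submatrix, Matrix.conjTranspose_conjTranspose,
      ← Matrix.submatrix_mul _ _ _ _ _ Function.bijective_id, hU1, Matrix.submatrix_one_equiv]
  · rw [Matrix.conjTranspose_submatrix, Matrix.conjTranspose_conjTranspose]
    rw [show U.conjTranspose.submatrix σ id * ρ = (U.conjTranspose * ρ).submatrix σ id from
      (Matrix.submatrix_mul _ _ _ _ _ Function.bijective_id).symm,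
      ← Matrix.submatrix_mul _ _ _ _ _ Function.bijective_id, hd, Matrix.submatrix_diagonal_equiv]
    rfl

lemma exists_isSpecDown {ρ : Matrix (Fin n) (Fin n) ℂ} (hρ : ρ.IsHermitian) :
    ∃ lam, IsSpecDown ρ lam := by
  refine ⟨hρ.eigenvalues ∘ Tuple.sort (fun i => -hρ.eigenvalues i), fun i j hij => ?_, hρ, _, rfl⟩
  exact neg_le_neg_iff.mp (Tuple.monotone_sort (fun i => -hρ.eigenvalues i) hij)

lemma isSpecDown_diagonal {lam : Fin n → ℝ} (hlam : Antitone lam) :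
    IsSpecDown (Matrix.diagonal fun i => (lam i : ℂ)) lam := by
  have hH : (Matrix.diagonal fun i => (lam i : ℂ)).IsHermitian := by
    rw [Matrix.IsHermitian, Matrix.diagonal_conjTranspose]
    congr 1
    ext i
    simp
  obtain ⟨mu, hmu⟩ := exists_isSpecDown hH
  obtain ⟨k, hk, hkd⟩ := hmu.exists_unitary
  have : mu = lam := eq_of_antitone_of_det_eq hmu.1 hlam fun z => by
    rw [← hkd, det_scalar_sub_conj hk]
  rwa [this] at hmu

end SpecDown

section MarginalCone

variable {F : Type*} [Fintype F] [DecidableEq F] {d : F → ℕ}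

/-- The cone of families of nonincreasing spectra of marginals. -/
def marginalCone (d : F → ℕ) : Set (∀ f, Fin (d f) → ℝ) :=
  {lam | (∀ f, Antitone (lam f)) ∧ ∃ ψ : (∀ f, Fin (d f)) → ℂ,
    ∀ f, marg f ψ = Matrix.diagonal fun i => (lam f i : ℂ)}

lemma sum_eq_nsq {lam : ∀ f, Fin (d f) → ℝ} {ψ : (∀ f, Fin (d f)) → ℂ}
    (h : ∀ f, marg f ψ = Matrix.diagonal fun i => (lam f i : ℂ)) (f : F) :
    ∑ i, lam f i = nsq ψ := by
  have h1 := trace_marg f ψ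
  rw [h f, Matrix.trace_diagonal] at h1
  exact_mod_cast h1

lemma marginalSpectra_subset_marginalCone : marginalSpectra d ⊆ marginalCone d :=
  fun _ ⟨h, ψ, _, hm⟩ => ⟨h, ψ, hm⟩

lemma smul_mem_marginalCone {lam : ∀ f, Fin (d f) → ℝ} (h : lam ∈ marginalCone d) {r : ℝ}
    (hr : 0 ≤ r) : r • lam ∈ marginalCone d := by
  obtain ⟨ha, ψ, hψ⟩ := h
  refine ⟨fun f i j hij => mul_le_mul_of_nonneg_left (ha f hij) hr,
    ((Real.sqrt r : ℝ) : ℂ) • ψ, fun f => ?_⟩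
  rw [marg_smul, hψ f, Complex.norm_real, Real.norm_of_nonneg (Real.sqrt_nonneg r), Real.sq_sqrt hr,
    ← Matrix.diagonal_smul]
  congr 1
  ext i
  simp

lemma inv_smul_mem_marginalSpectra {lam : ∀ f, Fin (d f) → ℝ} {ψ : (∀ f, Fin (d f)) → ℂ}
    (ha : ∀ f, Antitone (lam f)) (hψ : ∀ f, marg f ψ = Matrix.diagonal fun i => (lam f i : ℂ))
    (h0 : 0 < nsq ψ) : (nsq ψ)⁻¹ • lam ∈ marginalSpectra d := by
  have hr : 0 ≤ (nsq ψ)⁻¹ := inv_nonneg.mpr h0.le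
  refine ⟨fun f i j hij => mul_le_mul_of_nonneg_left (ha f hij) hr,
    ((Real.sqrt (nsq ψ)⁻¹ : ℝ) : ℂ) • ψ, ?_, fun f => ?_⟩
  · rw [nsq_smul, Complex.norm_real, Real.norm_of_nonneg (Real.sqrt_nonneg _), Real.sq_sqrt hr,
      inv_mul_cancel₀ h0.ne']
  · rw [marg_smul, hψ f, Complex.norm_real, Real.norm_of_nonneg (Real.sqrt_nonneg _),
      Real.sq_sqrt hr, ← Matrix.diagonal_smul]
    congr 1
    ext i
    simp

lemma add_mem_marginalCone {lam mu : ∀ f, Fin (d f) → ℝ} (h : lam ∈ marginalCone d)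
    (h' : mu ∈ marginalCone d) : lam + mu ∈ marginalCone d := by
  obtain ⟨ha, ψ, hψ⟩ := h
  obtain ⟨ha', φ, hφ⟩ := h'
  have hzero : ∀ {nu : ∀ f, Fin (d f) → ℝ} {χ : (∀ f, Fin (d f)) → ℂ},
      (∀ f, marg f χ = Matrix.diagonal fun i => (nu f i : ℂ)) → nsq χ = 0 → nu = 0 := by
    intro nu χ hχ h0
    rw [nsq_eq_zero] at h0
    ext f i
    have h1 := congrFun (congrFun (hχ f) i) i
    rw [h0, ← zero_smul ℂ (0 : (∀ f, Fin (d f)) → ℂ), marg_smul] at h1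
    simpa using h1.symm
  rcases (nsq_nonneg ψ).eq_or_lt with h0 | h0
  · rw [hzero hψ h0.symm, zero_add]
    exact ⟨ha', φ, hφ⟩
  rcases (nsq_nonneg φ).eq_or_lt with h1 | h1
  · rw [hzero hφ h1.symm, add_zero]
    exact ⟨ha, ψ, hψ⟩
  have hs : 0 < nsq ψ + nsq φ := add_pos h0 h1
  have hconv := convex_marginalSpectra (inv_smul_mem_marginalSpectra ha hψ h0)
    (inv_smul_mem_marginalSpectra ha' hφ h1) (div_nonneg h0.le hs.le) (div_nonneg h1.le hs.le)
    (by rw [← add_div, div_self hs.ne'])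
  have h2 := smul_mem_marginalCone (marginalSpectra_subset_marginalCone hconv) hs.le
  convert h2 using 1
  rw [smul_add, smul_smul, smul_smul, smul_smul, smul_smul]
  have e1 : (nsq ψ + nsq φ) * (nsq ψ / (nsq ψ + nsq φ)) * (nsq ψ)⁻¹ = 1 := by
    field_simp
  have e2 : (nsq ψ + nsq φ) * (nsq φ / (nsq ψ + nsq φ)) * (nsq φ)⁻¹ = 1 := by
    field_simp
  rw [e1, e2, one_smul, one_smul]

lemma marg_apply (f : F) (ψ : (∀ f, Fin (d f)) → ℂ) (i j : Fin (d f)) :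
    marg f ψ i j = ∑ x, if x f = j then ψ (Function.update x f i) * star (ψ x) else 0 := by
  simp only [marg, Matrix.of_apply, dotProduct, Pi.star_apply]
  refine Finset.sum_congr rfl fun x _ => ?_
  have h : (loc (at1 f (Matrix.single j i 1))).mulVec ψ x =
      if x f = j then ψ (Function.update x f i) else 0 := by
    rw [Matrix.mulVec, dotProduct, Finset.sum_eq_single (Function.update x f i)]
    · have h1 : loc (at1 f (Matrix.single j i (1 : ℂ))) x (Function.update x f i) =
          if x f = j then 1 else 0 := by
        simp only [kron, Matrix.of_apply]
        rw [← Finset.mul_prod_erase _ _ (Finset.mem_univ f), Finset.prod_eq_one]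
        · simp [at1, Matrix.single_apply, eq_comm]
        · intro g hg
          have hgf := Finset.ne_of_mem_erase hg
          simp [at1, hgf]
      rw [h1, ite_mul, one_mul, zero_mul]
    · intro y _ hy
      refine mul_eq_zero_of_left ?_ _
      obtain ⟨g, hg⟩ := Function.ne_iff.mp hy
      refine Finset.prod_eq_zero (Finset.mem_univ g) ?_
      by_cases hgf : g = f
      · subst hgf
        rw [Function.update_self] at hg
        simp [at1, hg.symm]
      · rw [Function.update_of_ne hgf] at hg
        simp [at1, hgf, Matrix.one_apply_ne hg.symm]
    · simp
  rw [h, mul_ite, mul_zero, mul_comm]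

end MarginalCone

section Tripartite

variable {a b c : ℕ}

/-- Index triples as dependent functions. -/
def tripleEquiv (a b c : ℕ) : Fin a × Fin b × Fin c ≃ ∀ f : Fin 3, Fin (![a, b, c] f) where
  toFun p f := match f with
    | 0 => p.1
    | 1 => p.2.1
    | 2 => p.2.2
  invFun x := (x 0, x 1, x 2)
  left_inv _ := rfl
  right_inv x := by
    ext f
    fin_cases f <;> rfl

/-- Triples of vectors as dependent families. -/
def tripleFamily (lam : (Fin a → ℝ) × (Fin b → ℝ) × (Fin c → ℝ)) :
    ∀ f : Fin 3, Fin (![a, b, c] f) → ℝ := fun f => match f with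
  | 0 => lam.1
  | 1 => lam.2.1
  | 2 => lam.2.2

lemma rhoA_eq_marg (ψ : Fin a × Fin b × Fin c → ℂ) :
    rhoA ψ = marg (d := ![a, b, c]) 0 (ψ ∘ (tripleEquiv a b c).symm) := by
  ext i i'
  refine Eq.trans ?_ (marg_apply (d := ![a, b, c]) 0 _ i i').symm
  change ∑ j, ∑ k, ψ (i, j, k) * (starRingEnd ℂ) (ψ (i', j, k)) = _
  rw [← (tripleEquiv a b c).sum_comp, Fintype.sum_prod_type]
  rw [Finset.sum_eq_single i']
  · rw [Fintype.sum_prod_type]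
    refine Finset.sum_congr rfl fun j _ => Finset.sum_congr rfl fun k _ => ?_
    rw [if_pos (by rfl)]
    rfl
  · intro l _ hl
    exact Finset.sum_eq_zero fun p _ => if_neg hl
  · simp

lemma rhoB_eq_marg (ψ : Fin a × Fin b × Fin c → ℂ) :
    rhoB ψ = marg (d := ![a, b, c]) 1 (ψ ∘ (tripleEquiv a b c).symm) := by
  ext j j'
  refine Eq.trans ?_ (marg_apply (d := ![a, b, c]) 1 _ j j').symm
  change ∑ i, ∑ k, ψ (i, j, k) * (starRingEnd ℂ) (ψ (i, j', k)) = _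
  rw [← (tripleEquiv a b c).sum_comp, Fintype.sum_prod_type]
  refine Finset.sum_congr rfl fun i _ => ?_
  rw [Fintype.sum_prod_type, Finset.sum_eq_single j']
  · refine Finset.sum_congr rfl fun k _ => ?_
    rw [if_pos (by rfl)]
    rfl
  · intro l _ hl
    exact Finset.sum_eq_zero fun p _ => if_neg hl
  · simp

lemma rhoC_eq_marg (ψ : Fin a × Fin b × Fin c → ℂ) :
    rhoC ψ = marg (d := ![a, b, c]) 2 (ψ ∘ (tripleEquiv a b c).symm) := by
  ext k k'
  refine Eq.trans ?_ (marg_apply (d := ![a, b, c]) 2 _ k k').symm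
  change ∑ i, ∑ j, ψ (i, j, k) * (starRingEnd ℂ) (ψ (i, j, k')) = _
  rw [← (tripleEquiv a b c).sum_comp, Fintype.sum_prod_type]
  refine Finset.sum_congr rfl fun i _ => ?_
  rw [Fintype.sum_prod_type]
  refine Finset.sum_congr rfl fun j _ => ?_
  rw [Finset.sum_eq_single k']
  · rw [if_pos (by rfl)]
    rfl
  · intro l _ hl
    exact if_neg hl
  · simp

lemma mem_KronCone_iff {lam : (Fin a → ℝ) × (Fin b → ℝ) × (Fin c → ℝ)} :
    lam ∈ KronCone a b c ↔ tripleFamily lam ∈ marginalCone ![a, b, c] := by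
  constructor
  · rintro ⟨ψ, hA, hB, hC⟩
    rw [rhoA_eq_marg] at hA
    rw [rhoB_eq_marg] at hB
    rw [rhoC_eq_marg] at hC
    have h : ∀ f, IsSpecDown (marg f (ψ ∘ (tripleEquiv a b c).symm)) (tripleFamily lam f) := by
      intro f
      fin_cases f
      exacts [hA, hB, hC]
    choose k hk hkd using fun f => (h f).exists_unitary
    exact ⟨fun f => (h f).1, _, fun f => (marg_loc hk f _).trans (hkd f)⟩
  · rintro ⟨ha, ψ, hψ⟩
    have h : ∀ f, IsSpecDown (marg f ψ) (tripleFamily lam f) := fun f => by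
      rw [hψ f]
      exact isSpecDown_diagonal (ha f)
    have hψ' : ψ = (ψ ∘ tripleEquiv a b c) ∘ (tripleEquiv a b c).symm := by
      ext x
      simp
    refine ⟨ψ ∘ tripleEquiv a b c, ?_, ?_, ?_⟩
    · rw [rhoA_eq_marg, ← hψ']
      exact h 0
    · rw [rhoB_eq_marg, ← hψ']
      exact h 1
    · rw [rhoC_eq_marg, ← hψ']
      exact h 2

lemma add_mem_KronCone {lam mu : (Fin a → ℝ) × (Fin b → ℝ) × (Fin c → ℝ)}
    (h : lam ∈ KronCone a b c) (h' : mu ∈ KronCone a b c) : lam + mu ∈ KronCone a b c := by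
  rw [mem_KronCone_iff] at h h' ⊢
  convert add_mem_marginalCone h h' using 1
  ext f
  fin_cases f <;> rfl

lemma antitone_of_mem_KronCone {lam : (Fin a → ℝ) × (Fin b → ℝ) × (Fin c → ℝ)}
    (h : lam ∈ KronCone a b c) : Antitone lam.1 ∧ Antitone lam.2.1 ∧ Antitone lam.2.2 := by
  obtain ⟨ψ, hA, hB, hC⟩ := h
  exact ⟨hA.1, hB.1, hC.1⟩

lemma sum_eq_of_mem_KronCone {lam : (Fin a → ℝ) × (Fin b → ℝ) × (Fin c → ℝ)}
    (h : lam ∈ KronCone a b c) :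
    ∑ i, lam.1 i = ∑ j, lam.2.1 j ∧ ∑ i, lam.1 i = ∑ k, lam.2.2 k := by
  obtain ⟨-, ψ, hψ⟩ := mem_KronCone_iff.mp h
  have h0 := sum_eq_nsq hψ 0
  have h1 := sum_eq_nsq hψ 1
  have h2 := sum_eq_nsq hψ 2
  exact ⟨h0.trans h1.symm, h0.trans h2.symm⟩

end Tripartite

section Facets

variable {a b c : ℕ}

lemma rhoA_isHermitian (ψ : Fin a × Fin b × Fin c → ℂ) : (rhoA ψ).IsHermitian := by
  rw [rhoA_eq_marg]
  exact marg_isHermitian _ _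

lemma rhoB_isHermitian (ψ : Fin a × Fin b × Fin c → ℂ) : (rhoB ψ).IsHermitian := by
  rw [rhoB_eq_marg]
  exact marg_isHermitian _ _

lemma rhoC_isHermitian (ψ : Fin a × Fin b × Fin c → ℂ) : (rhoC ψ).IsHermitian := by
  rw [rhoC_eq_marg]
  exact marg_isHermitian _ _

/-- A matrix in which exactly the rows up to `i` are nonzero, and these are orthonormal. -/
def truncatedIsometry {n : ℕ} {κ : Type*} [DecidableEq κ] (e : Fin n ↪ κ) (i p : Fin n) (x : κ) :
    ℂ :=
  if p ≤ i ∧ x = e p then 1 else 0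

lemma isSpecDown_truncatedIsometry {n : ℕ} {κ : Type*} [Fintype κ] [DecidableEq κ] (e : Fin n ↪ κ)
    (i : Fin n) :
    IsSpecDown (Matrix.of fun p p' => ∑ x, truncatedIsometry e i p x *
      (starRingEnd ℂ) (truncatedIsometry e i p' x)) fun p => if p ≤ i then 1 else 0 := by
  have hanti : Antitone fun p : Fin n => if p ≤ i then (1 : ℝ) else 0 := by
    intro p q hpq
    dsimp only
    split_ifs with h1 h2
    exacts [le_rfl, absurd (hpq.trans h1) h2, zero_le_one, le_rfl]
  convert isSpecDown_diagonal hanti using 1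
  ext p p'
  rw [Matrix.of_apply, Finset.sum_eq_single (e p)]
  · by_cases hp : p = p'
    · subst hp
      by_cases h : p ≤ i <;> simp [truncatedIsometry, h]
    · simp [truncatedIsometry, hp]
  · intro x _ hx
    simp [truncatedIsometry, hx]
  · simp

lemma exists_lt_of_le_A (h : a ≤ b * c) {i i' : Fin a} (hi : i < i') :
    ∃ lam ∈ KronCone a b c, lam.1 i' < lam.1 i := by
  obtain ⟨e⟩ : Nonempty (Fin a ↪ Fin b × Fin c) :=
    Function.Embedding.nonempty_of_card_le (by simpa using h)
  set ψ : Fin a × Fin b × Fin c → ℂ := fun p => truncatedIsometry e i p.1 p.2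
  obtain ⟨mB, hB⟩ := exists_isSpecDown (rhoB_isHermitian ψ)
  obtain ⟨mC, hC⟩ := exists_isSpecDown (rhoC_isHermitian ψ)
  refine ⟨(fun p => if p ≤ i then 1 else 0, mB, mC), ⟨ψ, ?_, hB, hC⟩, ?_⟩
  · convert isSpecDown_truncatedIsometry e i using 1
    ext p p'
    simp [rhoA, ψ, Fintype.sum_prod_type]
  · simp [hi.not_ge]

lemma exists_lt_of_le_B (h : b ≤ a * c) {j j' : Fin b} (hj : j < j') :
    ∃ lam ∈ KronCone a b c, lam.2.1 j' < lam.2.1 j := by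
  obtain ⟨e⟩ : Nonempty (Fin b ↪ Fin a × Fin c) :=
    Function.Embedding.nonempty_of_card_le (by simpa using h)
  set ψ : Fin a × Fin b × Fin c → ℂ := fun p => truncatedIsometry e j p.2.1 (p.1, p.2.2)
  obtain ⟨mA, hA⟩ := exists_isSpecDown (rhoA_isHermitian ψ)
  obtain ⟨mC, hC⟩ := exists_isSpecDown (rhoC_isHermitian ψ)
  refine ⟨(mA, fun p => if p ≤ j then 1 else 0, mC), ⟨ψ, hA, ?_, hC⟩, ?_⟩
  · convert isSpecDown_truncatedIsometry e j using 1
    ext p p'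
    simp [rhoB, ψ, Fintype.sum_prod_type]
  · simp [hj.not_ge]

lemma exists_lt_of_le_C (h : c ≤ a * b) {k k' : Fin c} (hk : k < k') :
    ∃ lam ∈ KronCone a b c, lam.2.2 k' < lam.2.2 k := by
  obtain ⟨e⟩ : Nonempty (Fin c ↪ Fin a × Fin b) :=
    Function.Embedding.nonempty_of_card_le (by simpa using h)
  set ψ : Fin a × Fin b × Fin c → ℂ := fun p => truncatedIsometry e k p.2.2 (p.1, p.2.1)
  obtain ⟨mA, hA⟩ := exists_isSpecDown (rhoA_isHermitian ψ)
  obtain ⟨mB, hB⟩ := exists_isSpecDown (rhoB_isHermitian ψ)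
  refine ⟨(mA, mB, fun p => if p ≤ k then 1 else 0), ⟨ψ, hA, hB, ?_⟩, ?_⟩
  · convert isSpecDown_truncatedIsometry e k using 1
    ext p p'
    simp [rhoC, ψ, Fintype.sum_prod_type]
  · simp [hk.not_ge]

lemma zero_mem_KronCone : (0 : (Fin a → ℝ) × (Fin b → ℝ) × (Fin c → ℝ)) ∈ KronCone a b c := by
  have h : ∀ n, IsSpecDown (0 : Matrix (Fin n) (Fin n) ℂ) 0 := fun n => by
    have h1 := isSpecDown_diagonal (n := n) (lam := 0) antitone_const
    rwa [show (Matrix.diagonal fun i => (((0 : Fin n → ℝ) i : ℝ) : ℂ)) = 0 by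
      simp] at h1
  refine ⟨0, ?_, ?_, ?_⟩
  · convert h a using 1
    · ext
      simp [rhoA]
    · rfl
  · convert h b using 1
    · ext
      simp [rhoB]
    · rfl
  · convert h c using 1
    · ext
      simp [rhoC]
    · rfl

/-- The pairing with `(H, z)` as a linear functional. -/
def wtPairL (HA : Fin a → ℝ) (HB : Fin b → ℝ) (HC : Fin c → ℝ) (z : ℝ) :
    (Fin a → ℝ) × (Fin b → ℝ) × (Fin c → ℝ) →ₗ[ℝ] ℝ where
  toFun := wtPair HA HB HC z
  map_add' x y := by
    simp only [wtPair, Prod.fst_add, Prod.snd_add, Pi.add_apply, mul_add, Finset.sum_add_distrib]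
    ring
  map_smul' r x := by
    simp only [wtPair, Prod.smul_fst, Prod.smul_snd, Pi.smul_apply, smul_eq_mul, RingHom.id_apply,
      mul_add, Finset.mul_sum]
    simp only [mul_left_comm]

/-- The face of the Kronecker cone on which `(H, z)` vanishes. -/
def faceMonoid (HA : Fin a → ℝ) (HB : Fin b → ℝ) (HC : Fin c → ℝ) (z : ℝ) :
    AddSubmonoid ((Fin a → ℝ) × (Fin b → ℝ) × (Fin c → ℝ)) where
  carrier := {lam ∈ KronCone a b c | wtPair HA HB HC z lam = 0}
  zero_mem' := ⟨zero_mem_KronCone, (wtPairL HA HB HC z).map_zero⟩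
  add_mem' {x y} hx hy := ⟨add_mem_KronCone hx.1 hy.1, by
    rw [show wtPair HA HB HC z (x + y) = _ from (wtPairL HA HB HC z).map_add x y]
    exact (congrArg₂ _ hx.2 hy.2).trans (add_zero 0)⟩

lemma exists_strictAnti {n : ℕ} {E : Type*} [AddCommMonoid E] (S : AddSubmonoid E)
    (f : E →+ (Fin n → ℝ)) (hf : ∀ x ∈ S, Antitone (f x))
    (h : ∀ i j, i < j → ∃ x ∈ S, f x j < f x i) : ∃ x ∈ S, StrictAnti (f x) := by
  have h' : ∀ p : Fin n × Fin n, ∃ x ∈ S, p.1 < p.2 → f x p.2 < f x p.1 := fun p => by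
    by_cases hp : p.1 < p.2
    · obtain ⟨x, hx, hlt⟩ := h _ _ hp
      exact ⟨x, hx, fun _ => hlt⟩
    · exact ⟨0, S.zero_mem, fun hp' => absurd hp' hp⟩
  choose x hx hlt using h'
  refine ⟨∑ p, x p, S.sum_mem fun p _ => hx p, fun i j hij => ?_⟩
  rw [map_sum, Finset.sum_apply, Finset.sum_apply]
  exact Finset.sum_lt_sum (fun p _ => hf _ (hx p) hij.le)
    ⟨(i, j), Finset.mem_univ _, hlt (i, j) hij⟩

/-- A functional vanishing on a facet is determined by the facet normal. -/
lemma IsFacetNormal.exists_eq_smul (ha : 0 < a) (hb : 0 < b) (hc : 0 < c)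
    {HA gA : Fin a → ℝ} {HB gB : Fin b → ℝ} {HC gC : Fin c → ℝ} {z : ℝ}
    (h : IsFacetNormal a b c HA HB HC z) (hg : Traceless gA gB gC)
    (hg0 : ¬ (gA = 0 ∧ gB = 0 ∧ gC = 0))
    (hF : ∀ lam ∈ KronCone a b c, wtPair HA HB HC z lam = 0 → wtPair gA gB gC 0 lam = 0) :
    z = 0 ∧ ∃ t : ℝ, t ≠ 0 ∧ HA = t • gA ∧ HB = t • gB ∧ HC = t • gC := by
  obtain ⟨⟨hHA, hHB, hHC⟩, hne, -, hdim⟩ := h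
  obtain ⟨hgA, hgB, hgC⟩ := hg
  set Φ : (Fin a → ℝ) × (Fin b → ℝ) × (Fin c → ℝ) →ₗ[ℝ] (Fin 4 → ℝ) :=
    LinearMap.pi ![wtPairL 0 (-1) 0 1, wtPairL 0 0 (-1) 1, wtPairL HA HB HC z,
      wtPairL gA gB gC 0] with hΦ
  have hker : (affineSpan ℝ {lam ∈ KronCone a b c | wtPair HA HB HC z lam = 0}).direction ≤
      LinearMap.ker Φ := by
    have h0 : ∀ x ∈ KronCone a b c, wtPair HA HB HC z x = 0 → Φ x = 0 := by
      intro x hx hx0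
      obtain ⟨h1, h2⟩ := sum_eq_of_mem_KronCone hx
      ext l
      fin_cases l
      · simp [hΦ, wtPairL, wtPair, h1]
      · simp [hΦ, wtPairL, wtPair, h2]
      · exact hx0
      · exact hF x hx hx0
    rw [direction_affineSpan, vectorSpan_def, Submodule.span_le]
    rintro _ ⟨x, ⟨hx, hx0⟩, y, ⟨hy, hy0⟩, rfl⟩
    simp [h0 x hx hx0, h0 y hy hy0]
  have hrange : LinearMap.range Φ < ⊤ := by
    refine lt_top_iff_ne_top.mpr fun htop => ?_
    have h1 := LinearMap.finrank_range_add_finrank_ker Φ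
    have h2 := Submodule.finrank_mono hker
    rw [hdim] at h2
    rw [htop, finrank_top] at h1
    simp only [Module.finrank_prod, Module.finrank_fin_fun] at h1
    omega
  obtain ⟨φ, hφ0, hφ⟩ := Submodule.exists_le_ker_of_lt_top _ hrange
  set α : Fin 4 → ℝ := fun l => φ (Pi.single l 1)
  have hφα : ∀ v, φ v = v 0 * α 0 + v 1 * α 1 + v 2 * α 2 + v 3 * α 3 := fun v => by
    conv_lhs => rw [pi_eq_sum_univ' v, map_sum]
    simp only [map_smul, smul_eq_mul, Fin.sum_univ_four]
    rfl
  have hzero : ∀ x, wtPair 0 (-1) 0 1 x * α 0 + wtPair 0 0 (-1) 1 x * α 1 +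
      wtPair HA HB HC z x * α 2 + wtPair gA gB gC 0 x * α 3 = 0 := fun x =>
    (hφα (Φ x)).symm.trans (hφ ⟨x, rfl⟩)
  have eA : ∀ i, α 0 + α 1 + (HA i + z) * α 2 + gA i * α 3 = 0 := fun i => by
    have := hzero (Pi.single i 1, 0, 0)
    simpa [wtPair, Pi.single_apply] using this
  have eB : ∀ j, -α 0 + HB j * α 2 + gB j * α 3 = 0 := fun j => by
    have := hzero (0, Pi.single j 1, 0)
    simpa [wtPair, Pi.single_apply] using this
  have eC : ∀ k, -α 1 + HC k * α 2 + gC k * α 3 = 0 := fun k => by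
    have := hzero (0, 0, Pi.single k 1)
    simpa [wtPair, Pi.single_apply] using this
  have h0 : α 0 = 0 := by
    have := Finset.sum_eq_zero fun j (_ : j ∈ Finset.univ) => eB j
    simp only [Finset.sum_add_distrib, ← Finset.sum_mul, hHB, hgB] at this
    simpa [hb.ne'] using this
  have h1 : α 1 = 0 := by
    have := Finset.sum_eq_zero fun j (_ : j ∈ Finset.univ) => eC j
    simp only [Finset.sum_add_distrib, ← Finset.sum_mul, hHC, hgC] at this
    simpa [hc.ne'] using this
  have h2 : z * α 2 = 0 := by
    have := Finset.sum_eq_zero fun j (_ : j ∈ Finset.univ) => eA j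
    simp only [Finset.sum_add_distrib, ← Finset.sum_mul, hHA, hgA, h0, h1] at this
    simpa [ha.ne'] using this
  have hα2 : α 2 ≠ 0 := by
    intro h3
    have h4 : α 3 ≠ 0 := by
      intro h4
      refine hφ0 (LinearMap.ext fun v => ?_)
      rw [hφα, h0, h1, h3, h4]
      simp
    refine hg0 ⟨?_, ?_, ?_⟩
    · ext i
      simpa [h0, h1, h3, h4] using eA i
    · ext i
      simpa [h0, h3, h4] using eB i
    · ext i
      simpa [h1, h3, h4] using eC i
  have hz : z = 0 := (mul_eq_zero.mp h2).resolve_right hα2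
  have key : ∀ {x y : ℝ}, x * α 2 + y * α 3 = 0 → x = (-α 3 / α 2) * y := by
    intro x y hxy
    field_simp
    linarith
  have hA : HA = (-α 3 / α 2) • gA := funext fun i => key <| by simpa [h0, h1, hz] using eA i
  have hB : HB = (-α 3 / α 2) • gB := funext fun i => key <| by simpa [h0] using eB i
  have hC : HC = (-α 3 / α 2) • gC := funext fun i => key <| by simpa [h1] using eC i
  refine ⟨hz, _, fun ht => hne ?_, hA, hB, hC⟩
  rw [hA, hB, hC, ht]
  simp [hz]

lemma single_sub_single_ne_zero {n : ℕ} {i i' : Fin n} (h : i ≠ i') :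
    (Pi.single i 1 - Pi.single i' 1 : Fin n → ℝ) ≠ 0 := fun h0 => by
  have := congrFun h0 i
  simp [h] at this

lemma sum_single_sub_single_mul {n : ℕ} (i i' : Fin n) (x : Fin n → ℝ) :
    ∑ l, (Pi.single i 1 - Pi.single i' 1 : Fin n → ℝ) l * x l = x i - x i' := by
  simp [sub_mul, Finset.sum_sub_distrib, Pi.single_apply]

/-- An inequality `0 ≤ t * x` with `t ≠ 0` and `0 < x` forces `t` to be positive. -/
lemma pos_of_mul_nonneg {t x : ℝ} (ht : t ≠ 0) (hx : 0 < x) (h : 0 ≤ t * x) : 0 < t :=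
  (nonneg_of_mul_nonneg_left h hx).lt_of_ne ht.symm

section

variable {HA : Fin a → ℝ} {HB : Fin b → ℝ} {HC : Fin c → ℝ} {z : ℝ}

lemma exists_face_lt_A (ha : 0 < a) (hb : 0 < b) (hc : 0 < c) (hle : a ≤ b * c)
    (hfacet : IsFacetNormal a b c HA HB HC z) (hnt : ¬ IsTrivialNormal HA HB HC z)
    {i i' : Fin a} (hi : i < i') : ∃ lam ∈ faceMonoid HA HB HC z, lam.1 i' < lam.1 i := by
  by_contra! hcon
  obtain ⟨hz, t, ht, hA, hB, hC⟩ := hfacet.exists_eq_smul ha hb hc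
    (gA := Pi.single i 1 - Pi.single i' 1) (gB := 0) (gC := 0) (by simp [Traceless])
    (fun h => single_sub_single_ne_zero hi.ne h.1) fun lam hlam h0 => by
      simp only [wtPair, sum_single_sub_single_mul]
      have h1 := hcon lam ⟨hlam, h0⟩
      have h2 := (antitone_of_mem_KronCone hlam).1 hi.le
      simp [le_antisymm h1 h2]
  rw [smul_zero] at hB hC
  obtain ⟨lam, hlam, hlt⟩ := exists_lt_of_le_A hle hi
  refine hnt ⟨t, pos_of_mul_nonneg ht (sub_pos.mpr hlt) ?_, Or.inl ⟨i, i', hi, hA, hB, hC, hz⟩⟩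
  have h := hfacet.2.2.1 lam hlam
  simpa only [wtPair, hA, hB, hC, hz, Pi.smul_apply, smul_eq_mul, mul_assoc, ← Finset.mul_sum,
    sum_single_sub_single_mul, Pi.zero_apply, zero_mul, Finset.sum_const_zero, add_zero] using h

lemma exists_face_lt_B (ha : 0 < a) (hb : 0 < b) (hc : 0 < c) (hle : b ≤ a * c)
    (hfacet : IsFacetNormal a b c HA HB HC z) (hnt : ¬ IsTrivialNormal HA HB HC z)
    {j j' : Fin b} (hj : j < j') : ∃ lam ∈ faceMonoid HA HB HC z, lam.2.1 j' < lam.2.1 j := by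
  by_contra! hcon
  obtain ⟨hz, t, ht, hA, hB, hC⟩ := hfacet.exists_eq_smul ha hb hc
    (gA := 0) (gB := Pi.single j 1 - Pi.single j' 1) (gC := 0) (by simp [Traceless])
    (fun h => single_sub_single_ne_zero hj.ne h.2.1) fun lam hlam h0 => by
      simp only [wtPair, sum_single_sub_single_mul]
      have h1 := hcon lam ⟨hlam, h0⟩
      have h2 := (antitone_of_mem_KronCone hlam).2.1 hj.le
      simp [le_antisymm h1 h2]
  rw [smul_zero] at hA hC
  obtain ⟨lam, hlam, hlt⟩ := exists_lt_of_le_B hle hj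
  refine hnt ⟨t, pos_of_mul_nonneg ht (sub_pos.mpr hlt) ?_,
    Or.inr (Or.inl ⟨j, j', hj, hB, hA, hC, hz⟩)⟩
  have h := hfacet.2.2.1 lam hlam
  simpa only [wtPair, hA, hB, hC, hz, Pi.smul_apply, smul_eq_mul, mul_assoc, ← Finset.mul_sum,
    sum_single_sub_single_mul, Pi.zero_apply, zero_mul, Finset.sum_const_zero, add_zero,
    zero_add] using h

lemma exists_face_lt_C (ha : 0 < a) (hb : 0 < b) (hc : 0 < c) (hle : c ≤ a * b)
    (hfacet : IsFacetNormal a b c HA HB HC z) (hnt : ¬ IsTrivialNormal HA HB HC z)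
    {k k' : Fin c} (hk : k < k') : ∃ lam ∈ faceMonoid HA HB HC z, lam.2.2 k' < lam.2.2 k := by
  by_contra! hcon
  obtain ⟨hz, t, ht, hA, hB, hC⟩ := hfacet.exists_eq_smul ha hb hc
    (gA := 0) (gB := 0) (gC := Pi.single k 1 - Pi.single k' 1) (by simp [Traceless])
    (fun h => single_sub_single_ne_zero hk.ne h.2.2) fun lam hlam h0 => by
      simp only [wtPair, sum_single_sub_single_mul]
      have h1 := hcon lam ⟨hlam, h0⟩
      have h2 := (antitone_of_mem_KronCone hlam).2.2 hk.le
      simp [le_antisymm h1 h2]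
  rw [smul_zero] at hA hB
  obtain ⟨lam, hlam, hlt⟩ := exists_lt_of_le_C hle hk
  refine hnt ⟨t, pos_of_mul_nonneg ht (sub_pos.mpr hlt) ?_,
    Or.inr (Or.inr ⟨k, k', hk, hC, hA, hB, hz⟩)⟩
  have h := hfacet.2.2.1 lam hlam
  simpa only [wtPair, hA, hB, hC, hz, Pi.smul_apply, smul_eq_mul, mul_assoc, ← Finset.mul_sum,
    sum_single_sub_single_mul, Pi.zero_apply, zero_mul, Finset.sum_const_zero, add_zero,
    zero_add] using h

end

end Facets

/-- any non-trivial facet meets the interior of the positive Weyl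
chamber. -/
theorem facet_contains_strictly_decreasing_point (a b c : ℕ)
    (ha : 1 < a) (hab : a ≤ b) (hbc : b ≤ c) (hcab : c ≤ a * b)
    (HA : Fin a → ℝ) (HB : Fin b → ℝ) (HC : Fin c → ℝ) (z : ℝ)
    (hfacet : IsFacetNormal a b c HA HB HC z)
    (hnt : ¬ IsTrivialNormal HA HB HC z) :
    ∃ lam ∈ KronCone a b c, wtPair HA HB HC z lam = 0 ∧
      StrictAnti lam.1 ∧ StrictAnti lam.2.1 ∧ StrictAnti lam.2.2 := by
  have ha0 : 0 < a := by omega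
  have hb0 : 0 < b := by omega
  have hc0 : 0 < c := by omega
  have hanti : ∀ lam ∈ faceMonoid HA HB HC z, _ := fun lam h => antitone_of_mem_KronCone h.1
  obtain ⟨x, hx, hxs⟩ := exists_strictAnti (faceMonoid HA HB HC z) (AddMonoidHom.fst _ _)
    (fun lam h => (hanti lam h).1) fun i i' =>
      exists_face_lt_A ha0 hb0 hc0 (hab.trans (Nat.le_mul_of_pos_right b hc0)) hfacet hnt
  obtain ⟨y, hy, hys⟩ := exists_strictAnti (faceMonoid HA HB HC z)
    ((AddMonoidHom.fst _ _).comp (AddMonoidHom.snd _ _))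
    (fun lam h => (hanti lam h).2.1) fun i i' =>
      exists_face_lt_B ha0 hb0 hc0 (hbc.trans (Nat.le_mul_of_pos_left c ha0)) hfacet hnt
  obtain ⟨w, hw, hws⟩ := exists_strictAnti (faceMonoid HA HB HC z)
    ((AddMonoidHom.snd _ _).comp (AddMonoidHom.snd _ _))
    (fun lam h => (hanti lam h).2.2) fun i i' => exists_face_lt_C ha0 hb0 hc0 hcab hfacet hnt
  have hsum := add_mem (add_mem hx hy) hw
  exact ⟨x + y + w, hsum.1, hsum.2,
    (hxs.add_antitone (hanti y hy).1).add_antitone (hanti w hw).1,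
    ((hanti x hx).2.1.add_strictAnti hys).add_antitone (hanti w hw).2.1,
    ((hanti x hx).2.2.add (hanti y hy).2.2).add_strictAnti hws⟩

end
end

section
/- Let n, r be positive integers and w : Fin n → ℝ^r a family of vectors whose span is all of ℝ^r. Define the torus moment map f : ℂ^n → ℝ^r by f(ψ) = Σ_i |ψ_i|² w_i. Then the set of critical values of f (the values f(ψ) at points ψ where the real Fréchet derivative of f is not surjective) is equal to the union, over all subsets S ⊆ Fin n such that the linear span of {w_i : i ∈ S} has dimension r − 1, of the conic hulls {Σ_{i ∈ S} c_i w_i : c_i ≥ 0 for all i ∈ S}. -/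
open scoped BigOperators

lemma fderiv_sum_norm_sq_smul {n r : ℕ} (w : Fin n → Fin r → ℝ) (ψ v : Fin n → ℂ) :
    fderiv ℝ (fun φ : Fin n → ℂ => ∑ i, ‖φ i‖ ^ 2 • w i) ψ v =
      ∑ i, (2 * inner ℝ (ψ i) (v i)) • w i := by
  have h (i : Fin n) := (((hasFDerivAt_apply (𝕜 := ℝ) i ψ).norm_sq).smul_const (w i))
  rw [(HasFDerivAt.fun_sum (u := Finset.univ) fun i _ => h i).fderiv]
  simp [mul_add]

/-- The derivative of the moment map at `ψ` is surjective exactly when the weights on the support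
of `ψ` span. -/
lemma surjective_fderiv_sum_norm_sq_smul_iff {n r : ℕ} (w : Fin n → Fin r → ℝ) (ψ : Fin n → ℂ) :
    Function.Surjective (fderiv ℝ (fun φ : Fin n → ℂ => ∑ i, ‖φ i‖ ^ 2 • w i) ψ) ↔
      Submodule.span ℝ (w '' {i | ψ i ≠ 0}) = ⊤ := by
  set L := fderiv ℝ (fun φ : Fin n → ℂ => ∑ i, ‖φ i‖ ^ 2 • w i) ψ with hL
  have hrange : LinearMap.range (L : (Fin n → ℂ) →ₗ[ℝ] (Fin r → ℝ)) =
      Submodule.span ℝ (w '' {i | ψ i ≠ 0}) := by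
    apply le_antisymm
    · rintro _ ⟨v, rfl⟩
      rw [ContinuousLinearMap.coe_coe, hL, fderiv_sum_norm_sq_smul]
      refine Submodule.sum_mem _ fun i _ => ?_
      by_cases hi : ψ i = 0
      · simp [hi]
      · exact Submodule.smul_mem _ _ (Submodule.subset_span ⟨i, hi, rfl⟩)
    · rw [Submodule.span_le]
      rintro _ ⟨i, hi, rfl⟩
      have hi' : ‖ψ i‖ ≠ 0 := norm_ne_zero_iff.mpr hi
      refine ⟨Pi.single i ((2 * ‖ψ i‖ ^ 2)⁻¹ • ψ i), ?_⟩
      rw [ContinuousLinearMap.coe_coe, hL, fderiv_sum_norm_sq_smul,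
        Finset.sum_eq_single_of_mem i (Finset.mem_univ i)]
      · rw [Pi.single_eq_same, real_inner_smul_right, real_inner_self_eq_norm_sq]
        have : 2 * ((2 * ‖ψ i‖ ^ 2)⁻¹ * ‖ψ i‖ ^ 2) = 1 := by field_simp
        rw [this, one_smul]
      · intro j _ hj
        simp [Pi.single_eq_of_ne hj]
  rw [← hrange, LinearMap.range_eq_top]
  rfl

/-- In a spanning family, a non-spanning subfamily extends to one spanning a hyperplane. -/
lemma exists_superset_finrank_span_eq {K V ι : Type*} [DivisionRing K] [AddCommGroup V]
    [Module K V] [FiniteDimensional K V] [Finite ι] (w : ι → V)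
    (hspan : Submodule.span K (Set.range w) = ⊤) (T : Finset ι)
    (hT : Submodule.span K (w '' (T : Set ι)) ≠ ⊤) :
    ∃ S : Finset ι, T ⊆ S ∧
      Module.finrank K (Submodule.span K (w '' (S : Set ι))) = Module.finrank K V - 1 := by
  classical
  obtain ⟨S, hTS, hS⟩ := (Set.toFinite
    {S : Finset ι | Submodule.span K (w '' (S : Set ι)) ≠ ⊤}).exists_le_maximal hT
  refine ⟨S, hTS, ?_⟩
  have hlt := Submodule.finrank_lt hS.prop
  obtain ⟨j, hj⟩ : ∃ j, j ∉ S := by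
    by_contra! h
    refine hS.prop ?_
    rw [Set.eq_univ_of_forall (s := (S : Set ι)) h, Set.image_univ, hspan]
  have htop : Submodule.span K (w '' ((insert j S : Finset ι) : Set ι)) = ⊤ := by
    by_contra h
    exact hj (hS.le_of_ge h (Finset.subset_insert j S) (Finset.mem_insert_self j S))
  rw [Finset.coe_insert, Set.image_insert_eq, Submodule.span_insert] at htop
  have hle := Submodule.finrank_add_le_finrank_add_finrank (K ∙ w j)
    (Submodule.span K (w '' (S : Set ι)))
  rw [htop, finrank_top] at hle
  have hone := finrank_span_le_card (R := K) ({w j} : Set V)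
  rw [Set.toFinset_card, Fintype.card_unique] at hone
  omega

/-- the critical values of a torus moment map `ψ ↦ ∑ |ψ_i|² w_i`
(with weights `w_i` spanning `ℝ^r`) are exactly the points lying in the conic
hull of some subset of weights spanning a subspace of dimension `r - 1`. -/
theorem torus_moment_map_critical_values (n r : ℕ) (hn : 0 < n) (hr : 0 < r)
    (w : Fin n → Fin r → ℝ)
    (hspan : Submodule.span ℝ (Set.range w) = ⊤) :
    { y : Fin r → ℝ |
        ∃ ψ : Fin n → ℂ,
          ¬ Function.Surjective
              (fderiv ℝ (fun φ : Fin n → ℂ => ∑ i, ‖φ i‖ ^ 2 • w i) ψ) ∧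
          (∑ i, ‖ψ i‖ ^ 2 • w i) = y }
      = ⋃ (S : Finset (Fin n))
          (_ : Module.finrank ℝ (Submodule.span ℝ (w '' ↑S)) = r - 1),
          { y : Fin r → ℝ | ∃ cf : Fin n → ℝ, (∀ i ∈ S, 0 ≤ cf i) ∧
              y = ∑ i ∈ S, cf i • w i } := by
  ext y
  simp only [Set.mem_ofPred_eq, Set.mem_iUnion, exists_prop,
    surjective_fderiv_sum_norm_sq_smul_iff]
  constructor
  · rintro ⟨ψ, hψ, rfl⟩
    have hcoe : {i | ψ i ≠ 0} = ((Finset.univ.filter fun i => ψ i ≠ 0 : Finset (Fin n)) :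
      Set (Fin n)) := by simp
    rw [hcoe] at hψ
    obtain ⟨S, hTS, hS⟩ := exists_superset_finrank_span_eq w hspan _ hψ
    rw [Module.finrank_fin_fun] at hS
    refine ⟨S, hS, fun i => ‖ψ i‖ ^ 2, fun i _ => by positivity, ?_⟩
    refine (Finset.sum_subset (Finset.subset_univ S) fun i _ hi => ?_).symm
    have : ψ i = 0 := by
      by_contra h
      exact hi (hTS (by simpa using h))
    simp [this]
  · rintro ⟨S, hS, c, hc, rfl⟩
    refine ⟨fun i => if i ∈ S then (Real.sqrt (c i) : ℂ) else 0, fun htop => ?_, ?_⟩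
    · have hle : Submodule.span ℝ (w '' {i | (if i ∈ S then (Real.sqrt (c i) : ℂ) else 0) ≠ 0}) ≤
          Submodule.span ℝ (w '' (S : Set (Fin n))) := by
        refine Submodule.span_mono (Set.image_mono fun i hi => ?_)
        by_contra h
        exact hi (if_neg h)
      rw [htop, top_le_iff] at hle
      rw [hle, finrank_top, Module.finrank_fin_fun] at hS
      omega
    · rw [← Finset.sum_subset (Finset.subset_univ S)]
      · refine Finset.sum_congr rfl fun i hi => ?_
        simp [hi, Real.sq_sqrt (hc i hi)]
      · intro i _ hi
        simp [hi]
end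

section
/- Let d be a positive integer, let H₀ ∈ ℝ^d have nonincreasing entries, and let H ∈ ℝ^d be a rearrangement of H₀ (i.e., H = H₀ ∘ σ⁻¹ coordinatewise for some permutation σ). Let w₀ ∈ S_d be the permutation w₀(i) = d + 1 − i. Then there exists a unique permutation w ∈ S_d such that H_i = H₀_{w⁻¹(i)} for all i and such that for all i < j with H₀_i = H₀_j one has (w₀∘w)(i) < (w₀∘w)(j); and for this w, the number of inversions of w₀∘w, namely #{(i,j) : i < j and (w₀∘w)(i) > (w₀∘w)(j)}, equals #{(i,j) : i < j and H_i > H_j}. -/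
/-- A permutation `w` carries the nonincreasing vector `H₀` to `H` and is decreasing on the level
sets of `H₀` exactly when its composite with the reversal sorts `H` stably. -/
theorem rearranges_and_rev_strict_on_levels_iff {d : ℕ} {α : Type*} [LinearOrder α]
    {H₀ H : Fin d → α} (hH₀ : Antitone H₀) {σ : Equiv.Perm (Fin d)}
    (hσ : ∀ i, H i = H₀ (σ⁻¹ i)) (w : Equiv.Perm (Fin d)) :
    ((∀ i, H i = H₀ (w⁻¹ i)) ∧
      (∀ i j : Fin d, i < j → H₀ i = H₀ j → (w i).rev < (w j).rev)) ↔
    Fin.revPerm.trans w = Tuple.sort H := by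
  have hHσ : H ∘ σ = H₀ := funext fun i => by simp [hσ]
  rw [Tuple.eq_sort_iff]
  constructor
  · rintro ⟨h1, h2⟩
    have hw : ∀ i, H (w i) = H₀ i := fun i => by simp [h1]
    refine ⟨fun i j hij => ?_, fun i j hij h => ?_⟩
    · simpa [hw] using hH₀ (Fin.rev_le_rev.2 hij)
    · have := h2 j.rev i.rev (Fin.rev_lt_rev.2 hij) (by simpa [hw] using h.symm)
      simpa using this
  · rintro ⟨h1, h2⟩
    have hanti : Antitone (H ∘ w) := fun i j hij => by
      simpa using h1 (Fin.rev_le_rev.2 hij)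
    have hw : H ∘ w = H₀ := by
      rw [← hHσ]
      exact Tuple.unique_antitone hanti (hHσ ▸ hH₀)
    refine ⟨fun i => by simp [← hw], fun i j hij h => ?_⟩
    have := h2 j.rev i.rev (Fin.rev_lt_rev.2 hij) (by simpa [← hw] using h.symm)
    simpa using this


/-- for a rearrangement `H` of a nonincreasing vector `H₀`, there is
a unique permutation `w` with `H = w · H₀` such that `w₀ ∘ w` is increasing on the
level sets of `H₀` (where `w₀ i = d + 1 - i` is the longest element, i.e.
`Fin.rev`); and for this `w`, the number of inversions of `w₀ ∘ w` equals the
number of pairs `i < j` with `H i > H j`. -/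
theorem length_w0w_eq_inversions (d : ℕ) (hd : 0 < d) (H₀ H : Fin d → ℝ)
    (hH₀ : Antitone H₀)
    (hperm : ∃ σ : Equiv.Perm (Fin d), ∀ i, H i = H₀ (σ⁻¹ i)) :
    (∃! w : Equiv.Perm (Fin d),
        (∀ i, H i = H₀ (w⁻¹ i)) ∧
        (∀ i j : Fin d, i < j → H₀ i = H₀ j → (w i).rev < (w j).rev)) ∧
    ∀ w : Equiv.Perm (Fin d),
      ((∀ i, H i = H₀ (w⁻¹ i)) ∧
        (∀ i j : Fin d, i < j → H₀ i = H₀ j → (w i).rev < (w j).rev)) →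
      Nat.card { p : Fin d × Fin d // p.1 < p.2 ∧ (w p.2).rev < (w p.1).rev }
        = Nat.card { p : Fin d × Fin d // p.1 < p.2 ∧ H p.2 < H p.1 } := by
  have key := rearranges_and_rev_strict_on_levels_iff hH₀ hperm.choose_spec
  refine ⟨⟨Fin.revPerm.trans (Tuple.sort H), (key _).2 (by ext; simp), fun w hw => ?_⟩, ?_⟩
  · rw [← (key w).1 hw]
    ext; simp
  · rintro w ⟨h1, h2⟩
    have hw : ∀ i, H (w i) = H₀ i := fun i => by simp [h1]
    refine Nat.card_congr ((w.prodCongr w).subtypeEquiv ?_)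
    rintro ⟨i, j⟩
    simp only [Equiv.prodCongr_apply, Prod.map_apply, hw, Fin.rev_lt_rev]
    constructor
    · rintro ⟨hij, hwij⟩
      exact ⟨hwij, (hH₀ hij.le).lt_of_ne fun h =>
        hwij.not_gt (Fin.rev_lt_rev.1 (h2 i j hij h.symm))⟩
    · rintro ⟨hwij, h⟩
      exact ⟨hH₀.reflect_lt h, hwij⟩
end
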